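/- arXiv:2404.01227 — 10 statements merged into one kernel-verified Lean document; each statement's English description precedes it below -/
import Mathlib

section
/- Suppose B ∈ M satisfies (3 + 2√2)·j·γ·‖B‖ < 1, and define Φ : M → M by Φ(X) = m(B, X) − n(X, J(X)) + B (in operator form, Φ(X) = BΓX − (ΓX)(JX) + B). Then Φ maps the closed ball 𝓑 = {X ∈ M : ‖X − B‖ ≤ √2·‖B‖} into itself and is Lipschitz on 𝓑 with constant (3 + 2√2)·j·γ·‖B‖ < 1; consequently Φ has a unique fixed point X* in 𝓑, and X* is the limit of the simple iterations X₁ = B, Xₙ₊₁ = Φ(Xₙ). (Fixed-point part of the paper's main abstract similarity theorem, Theorem 3.1.) -/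
open Filter Topology

/-- Contraction principle on a closed set, in real-valued form. -/
theorem exists_unique_fixedPoint_tendsto_of_isClosed {α : Type*} [MetricSpace α]
    [CompleteSpace α] {f : α → α} {s : Set α} {c : ℝ} (hs : IsClosed s)
    (hf : Set.MapsTo f s s) (hc0 : 0 ≤ c) (hc1 : c < 1)
    (hlip : ∀ x ∈ s, ∀ y ∈ s, dist (f x) (f y) ≤ c * dist x y) {x₀ : α} (hx₀ : x₀ ∈ s) :
    ∃ x ∈ s, f x = x ∧ (∀ y ∈ s, f y = y → y = x) ∧
      Tendsto (fun k => f^[k] x₀) atTop (𝓝 x) := by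
  have hcontr : ContractingWith ⟨c, hc0⟩ (hf.restrict f s s) :=
    ⟨by exact_mod_cast hc1,
      LipschitzWith.of_dist_le_mul fun x y => hlip x x.2 y y.2⟩
  obtain ⟨x, hxs, hfx, hlim, -⟩ :=
    hcontr.exists_fixedPoint' hs.isComplete hf hx₀ (edist_ne_top _ _)
  refine ⟨x, hxs, hfx, fun y hys hfy => ?_, hlim⟩
  have h := hlip y hys x hxs
  rw [hfy, hfx.eq] at h
  exact dist_le_zero.mp (by nlinarith [dist_nonneg (x := y) (y := x)])

/-- Estimate for the difference of two values of the quadratic map `X ↦ n(X, JX)`. -/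
theorem norm_bilinear_self_sub_le {M : Type*} [NormedAddCommGroup M] [NormedSpace ℂ M]
    {γ : ℝ} (hγ : 0 ≤ γ) (n : M →ₗ[ℂ] M →ₗ[ℂ] M)
    (hn : ∀ X Y : M, ‖n X Y‖ ≤ γ * ‖X‖ * ‖Y‖) (J : M →L[ℂ] M) (X Y : M) :
    ‖n X (J X) - n Y (J Y)‖ ≤ γ * ‖J‖ * (‖X‖ + ‖Y‖) * ‖X - Y‖ := by
  have hsplit : n X (J X) - n Y (J Y) = n (X - Y) (J X) + n Y (J (X - Y)) := by
    simp only [map_sub, LinearMap.sub_apply]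
    abel
  calc ‖n X (J X) - n Y (J Y)‖ ≤ ‖n (X - Y) (J X)‖ + ‖n Y (J (X - Y))‖ :=
        hsplit ▸ norm_add_le _ _
    _ ≤ γ * ‖X - Y‖ * ‖J X‖ + γ * ‖Y‖ * ‖J (X - Y)‖ := add_le_add (hn _ _) (hn _ _)
    _ ≤ γ * ‖X - Y‖ * (‖J‖ * ‖X‖) + γ * ‖Y‖ * (‖J‖ * ‖X - Y‖) := by
        gcongr <;> exact J.le_opNorm _
    _ = γ * ‖J‖ * (‖X‖ + ‖Y‖) * ‖X - Y‖ := by ring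

/-- Fixed-point part of Theorem 3.1 (main abstract similarity theorem) of the paper:
the map `Φ(X) = BΓX − (ΓX)(JX) + B`, written here via bilinear maps
`m(X,Y) = XΓY` and `n(X,Y) = (ΓX)Y`, maps the ball of radius `√2‖B‖` around `B`
into itself, is Lipschitz there with constant `(3+2√2)·j·γ·‖B‖ < 1`, and hence has a
unique fixed point there, which is the limit of simple iterations starting at `B`. -/
theorem stmt0 {M : Type*} [NormedAddCommGroup M] [NormedSpace ℂ M] [CompleteSpace M]
    (γ : ℝ) (hγ : 0 < γ)
    (m n : M →ₗ[ℂ] M →ₗ[ℂ] M)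
    (hm : ∀ X Y : M, ‖m X Y‖ ≤ γ * ‖X‖ * ‖Y‖)
    (hn : ∀ X Y : M, ‖n X Y‖ ≤ γ * ‖X‖ * ‖Y‖)
    (J : M →L[ℂ] M) (B : M)
    (hB : (3 + 2 * Real.sqrt 2) * max 1 ‖J‖ * γ * ‖B‖ < 1) :
    (∀ X : M, ‖X - B‖ ≤ Real.sqrt 2 * ‖B‖ →
        ‖(m B X - n X (J X) + B) - B‖ ≤ Real.sqrt 2 * ‖B‖) ∧
    (∀ X Y : M, ‖X - B‖ ≤ Real.sqrt 2 * ‖B‖ → ‖Y - B‖ ≤ Real.sqrt 2 * ‖B‖ →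
        ‖(m B X - n X (J X) + B) - (m B Y - n Y (J Y) + B)‖ ≤
          ((3 + 2 * Real.sqrt 2) * max 1 ‖J‖ * γ * ‖B‖) * ‖X - Y‖) ∧
    (∃ Xs : M, (‖Xs - B‖ ≤ Real.sqrt 2 * ‖B‖ ∧ m B Xs - n Xs (J Xs) + B = Xs) ∧
      (∀ Y : M, ‖Y - B‖ ≤ Real.sqrt 2 * ‖B‖ → m B Y - n Y (J Y) + B = Y → Y = Xs) ∧
      (∀ seq : ℕ → M, seq 0 = B →
        (∀ k : ℕ, seq (k + 1) = m B (seq k) - n (seq k) (J (seq k)) + B) →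
        Tendsto seq atTop (𝓝 Xs))) := by
  have hs : Real.sqrt 2 * Real.sqrt 2 = 2 := Real.mul_self_sqrt (by norm_num)
  have hs0 : 0 ≤ Real.sqrt 2 := Real.sqrt_nonneg 2
  set s := Real.sqrt 2
  set j := max 1 ‖J‖
  have hj1 : 1 ≤ j := le_max_left _ _
  have hJj : ‖J‖ ≤ j := le_max_right _ _
  have hj0 : 0 ≤ j := zero_le_one.trans hj1
  have hnorm : ∀ X : M, ‖X - B‖ ≤ s * ‖B‖ → ‖X‖ ≤ (1 + s) * ‖B‖ := fun X hX => by
    linarith [norm_le_norm_add_norm_sub' X B]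
  have hmj : ∀ X : M, ‖m B X‖ ≤ γ * j * ‖B‖ * ‖X‖ := fun X =>
    (hm B X).trans (by gcongr; exact le_mul_of_one_le_right hγ.le hj1)
  have hmaps : ∀ X : M, ‖X - B‖ ≤ s * ‖B‖ →
      ‖(m B X - n X (J X) + B) - B‖ ≤ s * ‖B‖ := fun X hX => by
    have hXn := hnorm X hX
    rw [add_sub_cancel_right]
    calc ‖m B X - n X (J X)‖ ≤ ‖m B X‖ + ‖n X (J X)‖ := norm_sub_le _ _
      _ ≤ γ * j * ‖B‖ * ‖X‖ + γ * ‖X‖ * (j * ‖X‖) :=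
          add_le_add (hmj X) ((hn _ _).trans (by gcongr; exact J.le_of_opNorm_le hJj X))
      _ ≤ γ * j * ‖B‖ * ((1 + s) * ‖B‖) +
          γ * ((1 + s) * ‖B‖) * (j * ((1 + s) * ‖B‖)) := by gcongr
      _ = ((3 + 2 * s) * j * γ * ‖B‖) * (s * ‖B‖) := by
          linear_combination (-γ * j * ‖B‖ ^ 2) * hs
      _ ≤ s * ‖B‖ := mul_le_of_le_one_left (by positivity) hB.le
  have hlip : ∀ X Y : M, ‖X - B‖ ≤ s * ‖B‖ → ‖Y - B‖ ≤ s * ‖B‖ →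
      ‖(m B X - n X (J X) + B) - (m B Y - n Y (J Y) + B)‖ ≤
        ((3 + 2 * s) * j * γ * ‖B‖) * ‖X - Y‖ := fun X Y hX hY => by
    have hXn := hnorm X hX
    have hYn := hnorm Y hY
    have hsplit : (m B X - n X (J X) + B) - (m B Y - n Y (J Y) + B) =
        m B (X - Y) - (n X (J X) - n Y (J Y)) := by
      rw [map_sub]
      abel
    calc ‖(m B X - n X (J X) + B) - (m B Y - n Y (J Y) + B)‖
        ≤ ‖m B (X - Y)‖ + ‖n X (J X) - n Y (J Y)‖ := hsplit ▸ norm_sub_le _ _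
      _ ≤ γ * j * ‖B‖ * ‖X - Y‖ + γ * ‖J‖ * (‖X‖ + ‖Y‖) * ‖X - Y‖ :=
          add_le_add (hmj _) (norm_bilinear_self_sub_le hγ.le n hn J X Y)
      _ ≤ γ * j * ‖B‖ * ‖X - Y‖ +
          γ * j * ((1 + s) * ‖B‖ + (1 + s) * ‖B‖) * ‖X - Y‖ := by gcongr
      _ = ((3 + 2 * s) * j * γ * ‖B‖) * ‖X - Y‖ := by ring
  refine ⟨hmaps, hlip, ?_⟩
  obtain ⟨Xs, hXs, hfix, huniq, hlim⟩ :=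
    exists_unique_fixedPoint_tendsto_of_isClosed
      (f := fun X => m B X - n X (J X) + B) (s := Metric.closedBall B (s * ‖B‖))
      (c := (3 + 2 * s) * j * γ * ‖B‖) Metric.isClosed_closedBall
      (fun X hX => mem_closedBall_iff_norm.mpr (hmaps X (mem_closedBall_iff_norm.mp hX)))
      (by positivity) hB
      (fun X hX Y hY => by
        simpa only [dist_eq_norm] using
          hlip X Y (mem_closedBall_iff_norm.mp hX) (mem_closedBall_iff_norm.mp hY))
      (Metric.mem_closedBall_self (by positivity))
  refine ⟨Xs, ⟨mem_closedBall_iff_norm.mp hXs, hfix⟩,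
    fun Y hY => huniq Y (mem_closedBall_iff_norm.mpr hY), fun seq h0 hsucc => ?_⟩
  convert hlim using 2 with k
  induction k with
  | zero => exact h0
  | succ k ih => rw [hsucc, ih, Function.iterate_succ_apply']
end

section
/- Suppose in addition that J is an idempotent (J∘J = J) and that J(n(X, J(Y))) = 0 for all X, Y ∈ M, and let B ∈ M satisfy 4·j·γ·‖B‖ < 1. Define Φ₁ : M → M by Φ₁(X) = m(B, X) − n(X, J(B)) − n(X, J(m(B, X))) + B (in operator form, Φ₁(X) = BΓX − (ΓX)JB − (ΓX)J(BΓX) + B). Then Φ₁ maps the closed ball {X ∈ M : ‖X − B‖ ≤ 3‖B‖} into itself and is a contraction on it, so Φ₁ has a unique fixed point X* in this ball, which is the limit of the simple iterations X₁ = B, Xₙ₊₁ = Φ₁(Xₙ). (Fixed-point part of Theorem 3.2, the idempotent case of the method of similar operators.) -/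
open Filter Topology

/-- Banach's fixed point theorem for a self-map of a closed ball. -/
theorem exists_unique_fixedPoint_closedBall {E : Type*} [NormedAddCommGroup E] [CompleteSpace E]
    {f : E → E} {c : E} {r q : ℝ} (hr : 0 ≤ r) (hq0 : 0 ≤ q) (hq1 : q < 1)
    (hmaps : ∀ x, ‖x - c‖ ≤ r → ‖f x - c‖ ≤ r)
    (hlip : ∀ x y, ‖x - c‖ ≤ r → ‖y - c‖ ≤ r → ‖f x - f y‖ ≤ q * ‖x - y‖) :
    ∃ x, (‖x - c‖ ≤ r ∧ f x = x) ∧ (∀ y, ‖y - c‖ ≤ r → f y = y → y = x) ∧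
      ∀ u : ℕ → E, u 0 = c → (∀ k, u (k + 1) = f (u k)) → Tendsto u atTop (𝓝 x) := by
  have hsf : Set.MapsTo f (Metric.closedBall c r) (Metric.closedBall c r) := by
    intro x hx
    rw [mem_closedBall_iff_norm] at hx ⊢
    exact hmaps x hx
  have hf : ContractingWith ⟨q, hq0⟩ (hsf.restrict f _ _) := by
    refine ⟨hq1, LipschitzWith.of_dist_le_mul fun x y => ?_⟩
    rw [Subtype.dist_eq, Subtype.dist_eq, dist_eq_norm, dist_eq_norm]
    exact hlip x y (mem_closedBall_iff_norm.1 x.2) (mem_closedBall_iff_norm.1 y.2)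
  obtain ⟨x, hx, hfix, hlim, -⟩ := hf.exists_fixedPoint' Metric.isClosed_closedBall.isComplete
    hsf (Metric.mem_closedBall_self hr) (edist_ne_top c (f c))
  rw [mem_closedBall_iff_norm] at hx
  refine ⟨x, ⟨hx, hfix⟩, fun y hy hfy => ?_, fun u hu0 hu => ?_⟩
  · have h := hlip y x hy hx
    rw [hfy, hfix.eq] at h
    have h0 : ‖y - x‖ = 0 := by nlinarith [norm_nonneg (y - x)]
    exact sub_eq_zero.1 (norm_eq_zero.1 h0)
  · have hiter : u = fun k => f^[k] c := by
      funext k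
      induction k with
      | zero => exact hu0
      | succ k ih => rw [hu, ih, Function.iterate_succ_apply']
    rwa [hiter]

/-- Fixed-point part of Theorem 3.2 of the paper (the idempotent case of the method of
similar operators): with `J` idempotent, `J((ΓX)(JY)) = 0`, and `4jγ‖B‖ < 1`, the map
`Φ₁(X) = BΓX − (ΓX)JB − (ΓX)J(BΓX) + B` maps the ball of radius `3‖B‖` around `B` into
itself, is a contraction there, and its unique fixed point in this ball is the limit of
simple iterations starting at `B`.  Here `m(X,Y) = XΓY` and `n(X,Y) = (ΓX)Y`. -/
theorem stmt1 {M : Type*} [NormedAddCommGroup M] [NormedSpace ℂ M] [CompleteSpace M]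
    (γ : ℝ) (hγ : 0 < γ)
    (m n : M →ₗ[ℂ] M →ₗ[ℂ] M)
    (hm : ∀ X Y : M, ‖m X Y‖ ≤ γ * ‖X‖ * ‖Y‖)
    (hn : ∀ X Y : M, ‖n X Y‖ ≤ γ * ‖X‖ * ‖Y‖)
    (J : M →L[ℂ] M)
    (hJidem : ∀ Y : M, J (J Y) = J Y)
    (hJn : ∀ X Y : M, J (n X (J Y)) = 0)
    (B : M)
    (hB : 4 * max 1 ‖J‖ * γ * ‖B‖ < 1) :
    (∀ X : M, ‖X - B‖ ≤ 3 * ‖B‖ →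
        ‖(m B X - n X (J B) - n X (J (m B X)) + B) - B‖ ≤ 3 * ‖B‖) ∧
    (∃ q : ℝ, 0 ≤ q ∧ q < 1 ∧
      ∀ X Y : M, ‖X - B‖ ≤ 3 * ‖B‖ → ‖Y - B‖ ≤ 3 * ‖B‖ →
        ‖(m B X - n X (J B) - n X (J (m B X)) + B) -
            (m B Y - n Y (J B) - n Y (J (m B Y)) + B)‖ ≤ q * ‖X - Y‖) ∧
    (∃ Xs : M,
      (‖Xs - B‖ ≤ 3 * ‖B‖ ∧ m B Xs - n Xs (J B) - n Xs (J (m B Xs)) + B = Xs) ∧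
      (∀ Y : M, ‖Y - B‖ ≤ 3 * ‖B‖ →
        m B Y - n Y (J B) - n Y (J (m B Y)) + B = Y → Y = Xs) ∧
      (∀ seq : ℕ → M, seq 0 = B →
        (∀ k : ℕ, seq (k + 1) =
          m B (seq k) - n (seq k) (J B) - n (seq k) (J (m B (seq k))) + B) →
        Tendsto seq atTop (𝓝 Xs))) := by
  set b := ‖B‖ with hb
  set j := max 1 ‖J‖
  have hj1 : 1 ≤ j := le_max_left _ _
  have hb0 : 0 ≤ b := norm_nonneg B
  have hγb : 0 ≤ γ * b := by positivity
  have ha0 : 0 ≤ j * γ * b := by positivity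
  have hγa : γ * b ≤ j * γ * b := by nlinarith
  have ha : j * γ * b < 1 / 4 := by linarith
  have hJ : ∀ Y, ‖J Y‖ ≤ j * ‖Y‖ := fun Y => J.le_of_opNorm_le (le_max_right _ _) Y
  have hball : ∀ X, ‖X - B‖ ≤ 3 * b → ‖X‖ ≤ 4 * b := fun X hX => by
    linarith [norm_le_norm_add_norm_sub' X B]
  have hmB : ∀ Y, ‖m B Y‖ ≤ j * γ * b * ‖Y‖ := fun Y =>
    (hm B Y).trans (mul_le_mul_of_nonneg_right hγa (norm_nonneg Y))
  have hnB : ∀ X, ‖n X (J B)‖ ≤ j * γ * b * ‖X‖ := fun X =>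
    calc ‖n X (J B)‖ ≤ γ * ‖X‖ * ‖J B‖ := hn X _
      _ ≤ γ * ‖X‖ * (j * b) := by gcongr; exact hJ B
      _ = j * γ * b * ‖X‖ := by ring
  have hnm : ∀ X Y, ‖n X (J (m B Y))‖ ≤ γ * (j * γ * b) * ‖X‖ * ‖Y‖ := fun X Y =>
    calc ‖n X (J (m B Y))‖ ≤ γ * ‖X‖ * ‖J (m B Y)‖ := hn X _
      _ ≤ γ * ‖X‖ * (j * (γ * b * ‖Y‖)) := by
        gcongr
        exact (hJ _).trans (by gcongr; exact hm B Y)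
      _ = γ * (j * γ * b) * ‖X‖ * ‖Y‖ := by ring
  have hmaps : ∀ X : M, ‖X - B‖ ≤ 3 * b →
      ‖(m B X - n X (J B) - n X (J (m B X)) + B) - B‖ ≤ 3 * b := by
    intro X hX
    have hX4 := hball X hX
    rw [add_sub_cancel_right]
    calc ‖m B X - n X (J B) - n X (J (m B X))‖
        ≤ ‖m B X‖ + ‖n X (J B)‖ + ‖n X (J (m B X))‖ :=
          (norm_sub_le _ _).trans (by gcongr; exact norm_sub_le _ _)
      _ ≤ j * γ * b * ‖X‖ + j * γ * b * ‖X‖ + γ * (j * γ * b) * ‖X‖ * ‖X‖ := by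
        gcongr
        exacts [hmB X, hnB X, hnm X X]
      _ ≤ j * γ * b * (4 * b) + j * γ * b * (4 * b)
            + γ * (j * γ * b) * (4 * b) * (4 * b) := by gcongr
      _ = 4 * b * (2 * (j * γ * b) + 4 * (j * γ * b) * (γ * b)) := by ring
      _ ≤ 4 * b * (2 * (1 / 4) + 4 * (1 / 4) * (1 / 4)) := by
        gcongr
        exact hγa.trans ha.le
      _ = 3 * b := by ring
  have hlip : ∀ X Y : M, ‖X - B‖ ≤ 3 * b → ‖Y - B‖ ≤ 3 * b →
      ‖(m B X - n X (J B) - n X (J (m B X)) + B) -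
          (m B Y - n Y (J B) - n Y (J (m B Y)) + B)‖ ≤ 4 * (j * γ * b) * ‖X - Y‖ := by
    intro X Y hX hY
    have hX4 := hball X hX
    have hY4 := hball Y hY
    have hdiff : (m B X - n X (J B) - n X (J (m B X)) + B) -
          (m B Y - n Y (J B) - n Y (J (m B Y)) + B) =
        m B (X - Y) - n (X - Y) (J B) - n (X - Y) (J (m B X)) - n Y (J (m B (X - Y))) := by
      simp only [map_sub, LinearMap.sub_apply]
      abel
    rw [hdiff]
    calc ‖m B (X - Y) - n (X - Y) (J B) - n (X - Y) (J (m B X)) - n Y (J (m B (X - Y)))‖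
        ≤ ‖m B (X - Y)‖ + ‖n (X - Y) (J B)‖ + ‖n (X - Y) (J (m B X))‖
            + ‖n Y (J (m B (X - Y)))‖ := by
          refine (norm_sub_le _ _).trans ?_
          gcongr
          refine (norm_sub_le _ _).trans ?_
          gcongr
          exact norm_sub_le _ _
      _ ≤ j * γ * b * ‖X - Y‖ + j * γ * b * ‖X - Y‖ + γ * (j * γ * b) * ‖X - Y‖ * ‖X‖
            + γ * (j * γ * b) * ‖Y‖ * ‖X - Y‖ := by
        gcongr
        exacts [hmB _, hnB _, hnm _ _, hnm _ _]
      _ ≤ j * γ * b * ‖X - Y‖ + j * γ * b * ‖X - Y‖ + γ * (j * γ * b) * ‖X - Y‖ * (4 * b)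
            + γ * (j * γ * b) * (4 * b) * ‖X - Y‖ := by gcongr
      _ = (2 * (j * γ * b) + 8 * (j * γ * b) * (γ * b)) * ‖X - Y‖ := by ring
      _ ≤ (2 * (j * γ * b) + 8 * (j * γ * b) * (1 / 4)) * ‖X - Y‖ := by
        gcongr
        exact hγa.trans ha.le
      _ = 4 * (j * γ * b) * ‖X - Y‖ := by ring
  have hq0 : 0 ≤ 4 * (j * γ * b) := by positivity
  have hq1 : 4 * (j * γ * b) < 1 := by linarith
  exact ⟨hmaps, ⟨_, hq0, hq1, hlip⟩,
    exists_unique_fixedPoint_closedBall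
      (f := fun X => m B X - n X (J B) - n X (J (m B X)) + B) (by positivity) hq0 hq1 hmaps hlip⟩
end

section
/- For every a > 0, the function φ_a is integrable and ∫_ℝ |φ_a(t)| dt ≤ 2^{3/2}·3^{−1/4}. (This is the paper's estimate ‖φ_a‖₁ ≤ 2^{3/2}·3^{−1/4}, obtained from the inequality ‖f‖₁² ≤ 2‖f̂‖₂‖(f̂)′‖₂ applied to the trapezoid function τ_a = φ̂_a, using ‖τ_a‖₂ ≤ 2√(2a/3) and ‖τ_a′‖₂ = √(2/a).) -/
open MeasureTheory

/-- The function `φ_a` from the paper (formula (2.7)), with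
`φ_a(t) = 2·sin(3at/2)·sin(at/2)/(πat²)` for `t ≠ 0` and `φ_a(0) = 3a/(2π)`. -/
noncomputable def phiF (a : ℝ) (t : ℝ) : ℝ :=
  if t = 0 then 3 * a / (2 * Real.pi)
  else 2 * Real.sin (3 * a * t / 2) * Real.sin (a * t / 2) / (Real.pi * a * t ^ 2)

theorem Real.sin_sq_le_sq_sub {u : ℝ} (hu : u ^ 2 ≤ 2) :
    Real.sin u ^ 2 ≤ u ^ 2 - u ^ 4 / 4 := by
  have h := Real.one_sub_sq_div_two_le_cos (x := u)
  have h2 := Real.sin_sq_add_cos_sq u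
  nlinarith [pow_le_pow_left₀ (by linarith : (0 : ℝ) ≤ 1 - u ^ 2 / 2) h 2]

theorem abs_sin_three_mul_mul_sin_le (u : ℝ) :
    |Real.sin (3 * u) * Real.sin u| ≤ 17 / 5 * u ^ 2 / (1 + 64 / 25 * u ^ 2) := by
  have hx : 0 ≤ u ^ 2 := sq_nonneg u
  have hprod : Real.sin (3 * u) * Real.sin u =
      Real.sin u ^ 2 * (3 - 4 * Real.sin u ^ 2) := by
    rw [Real.sin_three_mul]; ring
  have hy0 : 0 ≤ Real.sin u ^ 2 := sq_nonneg _
  have hy1 : Real.sin u ^ 2 ≤ 1 := Real.sin_sq_le_one u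
  have hyx : Real.sin u ^ 2 ≤ u ^ 2 := Real.sin_sq_le_sq
  rw [hprod, le_div_iff₀ (by positivity)]
  rcases le_total (5 / 4) (u ^ 2) with hu | hu
  · have : |Real.sin u ^ 2 * (3 - 4 * Real.sin u ^ 2)| ≤ 1 :=
      abs_le.2 ⟨by nlinarith, by nlinarith [sq_nonneg (Real.sin u ^ 2 - 3 / 8)]⟩
    nlinarith
  · have hy : Real.sin u ^ 2 ≤ 9 / 10 := by
      nlinarith [Real.sin_sq_le_sq_sub (u := u) (by linarith)]
    generalize Real.sin u ^ 2 = y at *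
    generalize u ^ 2 = x at *
    have h : |3 - 4 * y| * (1 + 64 / 25 * y) ≤ 17 / 5 := by
      rw [← abs_of_nonneg (by positivity : 0 ≤ 1 + 64 / 25 * y), ← abs_mul]
      exact abs_le.2 ⟨by nlinarith, by nlinarith [sq_nonneg (y - 23 / 128)]⟩
    have h3 : |3 - 4 * y| ≤ 17 / 5 := by
      nlinarith [mul_nonneg (abs_nonneg (3 - 4 * y)) hy0]
    rw [abs_mul, abs_of_nonneg hy0]
    calc y * |3 - 4 * y| * (1 + 64 / 25 * x)
        = y * (|3 - 4 * y| * (1 + 64 / 25 * y)) + 64 / 25 * y * |3 - 4 * y| * (x - y) := by ring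
      _ ≤ y * (17 / 5) + (17 / 5) * (x - y) := by
          have : 64 / 25 * y * |3 - 4 * y| ≤ 17 / 5 := by nlinarith [abs_nonneg (3 - 4 * y)]
          gcongr
      _ = 17 / 5 * x := by ring

theorem measurable_phiF (a : ℝ) : Measurable (phiF a) := by
  unfold phiF
  exact Measurable.ite (measurableSet_singleton 0) (by fun_prop) (by fun_prop)

theorem abs_phiF_le {a : ℝ} (ha : 0 < a) (t : ℝ) :
    |phiF a t| ≤ 17 * a / (10 * Real.pi) * (1 + (4 * a / 5 * t) ^ 2)⁻¹ := by
  have hpi := Real.pi_pos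
  unfold phiF
  split_ifs with ht
  · subst ht
    rw [abs_of_pos (by positivity)]
    simp only [mul_zero, ne_eq, OfNat.ofNat_ne_zero, not_false_eq_true, zero_pow, add_zero,
      inv_one, mul_one]
    rw [div_le_div_iff₀ (by positivity) (by positivity)]
    nlinarith [mul_pos ha hpi]
  · have h := abs_sin_three_mul_mul_sin_le (a * t / 2)
    rw [show 3 * (a * t / 2) = 3 * a * t / 2 by ring] at h
    have hd : 0 < Real.pi * a * t ^ 2 := by positivity
    rw [abs_div, abs_of_pos hd, mul_assoc, abs_mul, abs_two]
    calc _ ≤ 2 * (17 / 5 * (a * t / 2) ^ 2 / (1 + 64 / 25 * (a * t / 2) ^ 2)) /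
          (Real.pi * a * t ^ 2) := by gcongr
      _ = _ := by
          rw [show 64 / 25 * (a * t / 2) ^ 2 = (4 * a / 5 * t) ^ 2 by ring]
          have : 1 + (4 * a / 5 * t) ^ 2 ≠ 0 := by positivity
          generalize 1 + (4 * a / 5 * t) ^ 2 = D at *
          field_simp
          ring

theorem seventeen_eighths_le :
    (17 / 8 : ℝ) ≤ (2 : ℝ) ^ ((3 : ℝ) / 2) * (3 : ℝ) ^ (-(1 : ℝ) / 4) := by
  refine le_of_pow_le_pow_left₀ (n := 4) (by norm_num) (by positivity) ?_
  rw [mul_pow, ← Real.rpow_mul_natCast (by norm_num), ← Real.rpow_mul_natCast (by norm_num),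
    show (3 : ℝ) / 2 * (4 : ℕ) = (6 : ℕ) by norm_num,
    show -(1 : ℝ) / 4 * (4 : ℕ) = -1 by norm_num, Real.rpow_natCast, Real.rpow_neg_one]
  norm_num

/-- The paper's estimate `‖φ_a‖₁ ≤ 2^{3/2}·3^{−1/4}` for every `a > 0`. -/
theorem stmt6 (a : ℝ) (ha : 0 < a) :
    Integrable (phiF a) volume ∧
      (∫ t : ℝ, |phiF a t|) ≤ (2 : ℝ) ^ ((3 : ℝ) / 2) * (3 : ℝ) ^ (-(1 : ℝ) / 4) := by
  have hg : Integrable (fun t : ℝ ↦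
      17 * a / (10 * Real.pi) * (1 + (4 * a / 5 * t) ^ 2)⁻¹) volume :=
    (integrable_inv_one_add_sq.comp_mul_left' (by positivity)).const_mul _
  have hint : Integrable (phiF a) volume :=
    hg.mono' (measurable_phiF a).aestronglyMeasurable (.of_forall (abs_phiF_le ha))
  refine ⟨hint, (integral_mono hint.abs hg (abs_phiF_le ha)).trans ?_⟩
  rw [integral_const_mul, Measure.integral_comp_mul_left (fun x : ℝ ↦ (1 + x ^ 2)⁻¹),
    integral_univ_inv_one_add_sq, abs_of_pos (by positivity), smul_eq_mul]
  refine le_trans (le_of_eq ?_) seventeen_eighths_le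
  field_simp
  norm_num
end

section
/- For every a > 0 there exists a function ψ_a ∈ L¹(ℝ, ℂ) whose Fourier transform equals ω_a, i.e. ∫_ℝ ψ_a(t)·e^{−iλt} dt = ω_a(λ) for every λ ∈ ℝ, and which satisfies ‖ψ_a‖₁ ≤ (2/a)·(2(1 − ln 2)/3)^{1/4}; in particular ‖ψ_a‖₁ ≤ 1.35/a. -/
open MeasureTheory

/-- The trapezoid function `τ_a` from the paper. -/
noncomputable def trapF (a : ℝ) (l : ℝ) : ℝ :=
  if |l| ≤ a then 1
  else if |l| ≤ 2 * a then (2 * a - |l|) / a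
  else 0

/-- The function `ω_a(λ) = (1 − τ_a(λ))/λ` (with `ω_a(0) = 0`) from the paper;
explicitly, `ω_a = 0` on `[−a,a]`, `ω_a(λ) = ±1/a − 1/λ` on `a < |λ| ≤ 2a`, and
`ω_a(λ) = 1/λ` for `|λ| > 2a`. -/
noncomputable def omegaF (a : ℝ) (l : ℝ) : ℝ :=
  if l = 0 then 0 else (1 - trapF a l) / l

section

open Real Set Filter Topology FourierTransform SchwartzMap
open scoped ContDiff LineDeriv

theorem ae_eq_of_forall_integral_schwartz_mul {f g : ℝ → ℂ} (hf : LocallyIntegrable f)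
    (hg : LocallyIntegrable g) (h : ∀ φ : 𝓢(ℝ, ℂ), ∫ x, φ x * f x = ∫ x, φ x * g x) :
    f =ᵐ[volume] g := by
  refine ae_eq_of_integral_contDiff_smul_eq hf hg fun φ hφ hφc ↦ ?_
  have h₁ : HasCompactSupport (Complex.ofRealCLM ∘ φ) := hφc.comp_left rfl
  have h₂ : ContDiff ℝ ∞ (Complex.ofRealCLM ∘ φ) := by fun_prop
  simpa using h (h₁.toSchwartzMap h₂)

theorem fourierInv_ae_eq_of_weak_deriv (W V : Lp ℂ 2 (volume : Measure ℝ))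
    (h : ∀ φ : 𝓢(ℝ, ℂ), ∫ x, φ x * V x = - ∫ x, deriv φ x * W x) :
    ∀ᵐ x : ℝ, (𝓕⁻ V : Lp ℂ 2 (volume : Measure ℝ)) x
      = -(2 * π * Complex.I) * (x * (𝓕⁻ W : Lp ℂ 2 (volume : Measure ℝ)) x) := by
  have hd : ∂_{(1 : ℝ)} (Lp.toTemperedDistribution W) = Lp.toTemperedDistribution V := by
    ext φ
    simp only [TemperedDistribution.lineDerivOp_apply_apply, Lp.toTemperedDistribution_apply,
      smul_eq_mul, h, neg_apply, neg_mul, integral_neg,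
      SchwartzMap.lineDerivOp_apply_eq_fderiv, fderiv_apply_one_eq_deriv]
  have key := TemperedDistribution.fourierInv_lineDerivOp_eq (Lp.toTemperedDistribution W) 1
  rw [hd, Lp.fourierInv_toTemperedDistribution_eq, Lp.fourierInv_toTemperedDistribution_eq] at key
  have hW := (Lp.memLp (𝓕⁻ W : Lp ℂ 2 (volume : Measure ℝ))).locallyIntegrable (by norm_num)
  have hV := (Lp.memLp (𝓕⁻ V : Lp ℂ 2 (volume : Measure ℝ))).locallyIntegrable (by norm_num)
  refine ae_eq_of_forall_integral_schwartz_mul hV ?_ fun φ ↦ ?_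
  · have : LocallyIntegrable (fun x : ℝ ↦ (-(2 * π * Complex.I) * (x : ℂ)) •
        (𝓕⁻ W : Lp ℂ 2 (volume : Measure ℝ)) x) := by
      rw [← locallyIntegrableOn_univ] at hW ⊢
      exact hW.continuousOn_smul isOpen_univ.isLocallyClosed
        (g := fun x : ℝ ↦ -(2 * π * Complex.I) * (x : ℂ)) (by fun_prop)
    simpa [mul_assoc] using this
  · have := congrArg (fun T ↦ T φ) key
    have ht : (fun x : ℝ ↦ (x : ℂ)).HasTemperateGrowth := by fun_prop
    simp only [Lp.toTemperedDistribution_apply, smul_eq_mul] at this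
    rw [this]
    have hin : (fun x : ℝ ↦ ((inner ℝ x (1 : ℝ) : ℝ) : ℂ)) = fun x : ℝ ↦ (x : ℂ) := by
      ext x
      simp
    simp only [hin, smul_apply,
      TemperedDistribution.smulLeftCLM_apply_apply, Lp.toTemperedDistribution_apply,
      smul_eq_mul, ← integral_const_mul]
    refine integral_congr_ae (.of_forall fun x ↦ ?_)
    simp only [SchwartzMap.smulLeftCLM_apply_apply ht, smul_eq_mul]
    ring

theorem integral_norm_sq_eq (f : Lp ℂ 2 (volume : Measure ℝ)) :
    ∫ x, ‖f x‖ ^ 2 = ‖f‖ ^ 2 := by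
  have h := L2.inner_def (𝕜 := ℂ) f f
  simp_rw [inner_self_eq_norm_sq_to_K] at h
  have h' : ((‖f‖ ^ 2 : ℝ) : ℂ) = ((∫ x, ‖f x‖ ^ 2 : ℝ) : ℂ) := by
    rw [← integral_complex_ofReal]
    simpa using h
  exact_mod_cast h'.symm

theorem fourier_eq_of_fourierInv (W : Lp ℂ 2 (volume : Measure ℝ)) {w : ℝ → ℂ}
    (hw : Continuous w) (hWw : W =ᵐ[volume] w)
    (hi : Integrable (𝓕⁻ W : Lp ℂ 2 (volume : Measure ℝ))) :
    𝓕 ((𝓕⁻ W : Lp ℂ 2 (volume : Measure ℝ)) : ℝ → ℂ) = w := by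
  set g : ℝ → ℂ := ((𝓕⁻ W : Lp ℂ 2 (volume : Measure ℝ)) : ℝ → ℂ) with hg
  have hc : Continuous (𝓕 g) :=
    VectorFourier.fourierIntegral_continuous continuous_fourierChar
      (by exact continuous_inner (𝕜 := ℝ)) hi
  refine (hc.ae_eq_iff_eq volume hw).1 ?_
  refine ae_eq_of_forall_integral_schwartz_mul hc.locallyIntegrable hw.locallyIntegrable fun φ ↦ ?_
  have h₁ : ∫ x, φ x * 𝓕 g x = ∫ x, 𝓕 φ x * g x := by
    have := VectorFourier.integral_bilin_fourierIntegral_eq_flip (.mul ℂ ℂ) (L := innerₗ ℝ)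
      continuous_fourierChar continuous_inner (φ.integrable (μ := volume)) hi
    simpa using! this.symm
  have h₂ := congrArg (fun T ↦ T φ) (Lp.fourier_toTemperedDistribution_eq (𝓕⁻ W))
  simp only [TemperedDistribution.fourier_apply, Lp.toTemperedDistribution_apply, smul_eq_mul,
    FourierTransform.fourier_fourierInv_eq] at h₂
  rw [h₁, h₂]
  refine integral_congr_ae ?_
  filter_upwards [hWw] with x hx
  rw [hx]

/-- A form of Carlson's inequality, with free parameters `p` and `r`. -/
theorem integrable_and_integral_norm_le_of_sq {g : ℝ → ℂ} (hg : AEStronglyMeasurable g)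
    (h₀ : Integrable fun x ↦ ‖g x‖ ^ 2) (h₁ : Integrable fun x : ℝ ↦ ‖x * g x‖ ^ 2)
    {p r : ℝ} (hp : 0 < p) (hr : 0 < r) :
    Integrable g ∧ ∫ x, ‖g x‖ ≤ (p * (∫ x, ‖g x‖ ^ 2) + p * r ^ 2 * (∫ x : ℝ, ‖x * g x‖ ^ 2)
      + π / (p * r)) / 2 := by
  have hk : Integrable fun x : ℝ ↦ p⁻¹ * (1 + (r * x) ^ 2)⁻¹ :=
    (integrable_inv_one_add_sq.comp_mul_left' hr.ne').const_mul _
  have hI : Integrable fun x : ℝ ↦ (p * ‖g x‖ ^ 2 + p * r ^ 2 * ‖x * g x‖ ^ 2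
      + p⁻¹ * (1 + (r * x) ^ 2)⁻¹) / 2 :=
    (((h₀.const_mul p).add (h₁.const_mul (p * r ^ 2))).add hk).div_const 2
  have hle : ∀ x : ℝ, ‖g x‖ ≤ (p * ‖g x‖ ^ 2 + p * r ^ 2 * ‖x * g x‖ ^ 2
      + p⁻¹ * (1 + (r * x) ^ 2)⁻¹) / 2 := fun x ↦ by
    have hs : 0 < p * (1 + (r * x) ^ 2) := by positivity
    have h2 : 0 ≤ (p * (1 + (r * x) ^ 2))⁻¹ * (p * (1 + (r * x) ^ 2) * ‖g x‖ - 1) ^ 2 := by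
      positivity
    have h3 : (p * (1 + (r * x) ^ 2))⁻¹ * (p * (1 + (r * x) ^ 2) * ‖g x‖ - 1) ^ 2
        = p * (1 + (r * x) ^ 2) * ‖g x‖ ^ 2 - 2 * ‖g x‖ + (p * (1 + (r * x) ^ 2))⁻¹ := by
      field_simp
      ring
    have h4 : ‖(x : ℂ) * g x‖ ^ 2 = x ^ 2 * ‖g x‖ ^ 2 := by simp [mul_pow]
    rw [h3, mul_inv] at h2
    rw [h4]
    linarith
  refine ⟨hI.mono' hg (.of_forall hle), ?_⟩
  refine (integral_mono_of_nonneg (.of_forall fun x ↦ norm_nonneg _) hI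
    (.of_forall hle)).trans_eq ?_
  have hk' : Integrable fun x : ℝ ↦ p * ‖g x‖ ^ 2 + p * r ^ 2 * ‖x * g x‖ ^ 2 :=
    (h₀.const_mul p).add (h₁.const_mul (p * r ^ 2))
  rw [integral_div, integral_add hk' hk, integral_add (h₀.const_mul p) (h₁.const_mul (p * r ^ 2)),
    integral_const_mul, integral_const_mul, integral_const_mul,
    Measure.integral_comp_mul_left (fun x : ℝ ↦ (1 + x ^ 2)⁻¹), integral_univ_inv_one_add_sq,
    abs_of_pos (inv_pos.2 hr)]
  congr 2
  simp only [smul_eq_mul]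
  field_simp

theorem exists_integrable_fourier_eq {w v : ℝ → ℂ} (hw : Continuous w) (hw₂ : MemLp w 2)
    (hv₂ : MemLp v 2)
    (h : ∀ φ : 𝓢(ℝ, ℂ), ∫ x, φ x * v x = - ∫ x, deriv φ x * w x)
    {p r : ℝ} (hp : 0 < p) (hr : 0 < r) :
    ∃ g : ℝ → ℂ, Integrable g ∧ 𝓕 g = w ∧ ∫ x, ‖g x‖ ≤ (p * (∫ x, ‖w x‖ ^ 2)
      + p * r ^ 2 / (2 * π) ^ 2 * (∫ x : ℝ, ‖v x‖ ^ 2) + π / (p * r)) / 2 := by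
  have hW := hw₂.coeFn_toLp
  have hV := hv₂.coeFn_toLp
  set W := hw₂.toLp w
  set V := hv₂.toLp v
  have hd := fourierInv_ae_eq_of_weak_deriv W V fun φ ↦ by
    have e₁ : ∫ x, φ x * V x = ∫ x, φ x * v x := integral_congr_ae (hV.mono fun x hx ↦ by
      simp only [hx])
    have e₂ : ∫ x, deriv φ x * W x = ∫ x, deriv φ x * w x :=
      integral_congr_ae (hW.mono fun x hx ↦ by simp only [hx])
    rw [e₁, e₂, h φ]
  set g : Lp ℂ 2 (volume : Measure ℝ) := 𝓕⁻ W with hg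
  set f : Lp ℂ 2 (volume : Measure ℝ) := 𝓕⁻ V with hf
  have e₀ : ∫ x, ‖g x‖ ^ 2 = ∫ x, ‖w x‖ ^ 2 := by
    have hn : ‖g‖ = ‖W‖ := (Lp.fourierTransformₗᵢ ℝ ℂ).symm.norm_map W
    rw [integral_norm_sq_eq, hn, ← integral_norm_sq_eq]
    exact integral_congr_ae (hW.mono fun x hx ↦ by simp only [hx])
  have e₁ : ∫ x, ‖f x‖ ^ 2 = ∫ x, ‖v x‖ ^ 2 := by
    have hn : ‖f‖ = ‖V‖ := (Lp.fourierTransformₗᵢ ℝ ℂ).symm.norm_map V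
    rw [integral_norm_sq_eq, hn, ← integral_norm_sq_eq]
    exact integral_congr_ae (hV.mono fun x hx ↦ by simp only [hx])
  have hx : (fun x : ℝ ↦ ‖x * g x‖ ^ 2) =ᵐ[volume] fun x ↦ ((2 * π) ^ 2)⁻¹ * ‖f x‖ ^ 2 := by
    filter_upwards [hd] with x hx
    rw [hx, norm_mul]
    simp [abs_of_pos pi_pos]
    field_simp
  have h₀ := (memLp_two_iff_integrable_sq_norm (Lp.aestronglyMeasurable g)).1 (Lp.memLp g)
  have h₁ := (memLp_two_iff_integrable_sq_norm (Lp.aestronglyMeasurable f)).1 (Lp.memLp f)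
  obtain ⟨hgi, hgn⟩ := integrable_and_integral_norm_le_of_sq (Lp.aestronglyMeasurable g) h₀
    ((h₁.const_mul _).congr hx.symm) hp hr
  refine ⟨g, hgi, fourier_eq_of_fourierInv W hw hW hgi, hgn.trans_eq ?_⟩
  rw [integral_congr_ae hx, integral_const_mul, e₀, e₁]
  ring

theorem integral_schwartz_mul_deriv {w v : ℝ → ℂ} (hw : Continuous w) (hw₂ : MemLp w 2)
    (hv₂ : MemLp v 2) {C : ℝ} (hC : ∀ x, ‖w x‖ ≤ C) {s : Set ℝ} (hs : s.Countable)
    (hd : ∀ x ∉ s, HasDerivAt w (v x) x) (φ : 𝓢(ℝ, ℂ)) : ∫ x, φ x * v x = - ∫ x, deriv φ x * w x := by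
  have i₁ : Integrable fun x ↦ φ x * v x := (φ.memLp 2).integrable_mul hv₂
  have i₂ : Integrable fun x ↦ deriv φ x * w x :=
    ((SchwartzMap.derivCLM ℝ ℂ φ).memLp 2).integrable_mul hw₂
  have i₃ : Integrable fun x ↦ φ x * w x := (φ.memLp 2).integrable_mul hw₂
  have hder : ∀ x ∉ s, HasDerivAt (fun x ↦ φ x * w x) (deriv φ x * w x + φ x * v x) x :=
    fun x hx ↦ (φ.differentiableAt.hasDerivAt).mul (hd x hx)
  have hc : Continuous fun x ↦ φ x * w x := φ.continuous.mul hw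
  have hii := i₂.add i₁
  have hFTC : ∀ a b, ∫ x in a..b, (deriv φ x * w x + φ x * v x) = φ b * w b - φ a * w a :=
    fun a b ↦ integral_eq_of_hasDerivAt_off_countable (fun x ↦ φ x * w x) _ hs hc.continuousOn
      (fun x hx ↦ hder x hx.2) hii.intervalIntegrable
  have hlim := intervalIntegral_tendsto_integral hii tendsto_neg_atTop_atBot tendsto_id
  have h0 : Tendsto (fun x ↦ φ x * w x) (cocompact ℝ) (𝓝 0) :=
    φ.tendsto_cocompact.zero_mul_isBoundedUnder_le
      (isBoundedUnder_of ⟨C, hC⟩)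
  have h0' := (h0.comp (tendsto_id.mono_right atTop_le_cocompact)).sub
    (h0.comp (tendsto_neg_atTop_atBot.mono_right atBot_le_cocompact))
  have h1 := tendsto_nhds_unique hlim (h0'.congr fun x ↦ (hFTC (-x) x).symm)
  simp only [Pi.add_apply] at h1
  rw [integral_add i₂ i₁, sub_zero] at h1
  exact eq_neg_of_add_eq_zero_right h1

theorem omegaF_mul_left {a : ℝ} (ha : 0 < a) (l : ℝ) : omegaF a (a * l) = omegaF 1 l / a := by
  have h : trapF a (a * l) = trapF 1 l := by
    have h1 : |a * l| = a * |l| := by rw [abs_mul, abs_of_pos ha]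
    have h2 : a * |l| ≤ a ↔ |l| ≤ 1 := by
      simpa using mul_le_mul_iff_right₀ (b := |l|) (c := 1) ha
    have h3 : a * |l| ≤ 2 * a ↔ |l| ≤ 2 := by
      rw [mul_comm 2 a]; exact mul_le_mul_iff_right₀ ha
    simp only [trapF, h1, h2, h3, mul_one, div_one]
    congr 2
    field_simp
  rcases eq_or_ne l 0 with rfl | hl
  · simp [omegaF]
  · simp only [omegaF, h, hl, mul_eq_zero, ha.ne', or_self, if_false]
    field_simp

theorem trapF_one_eq (l : ℝ) : trapF 1 l = max 0 (min 1 (2 - |l|)) := by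
  unfold trapF
  split_ifs with h₁ h₂
  · rw [min_eq_left (by linarith), max_eq_right zero_le_one]
  · rw [min_eq_right (by linarith), max_eq_right (by linarith)]; ring
  · rw [min_eq_right (by linarith), max_eq_left (by linarith)]

theorem omegaF_one_of_abs_le {l : ℝ} (h : |l| ≤ 1) : omegaF 1 l = 0 := by
  simp [omegaF, trapF, h]

theorem continuous_omegaF_one : Continuous (omegaF 1) := by
  refine continuous_iff_continuousAt.2 fun l ↦ ?_
  rcases eq_or_ne l 0 with rfl | hl
  · refine (continuousAt_const (y := (0 : ℝ))).congr ?_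
    filter_upwards [Metric.ball_mem_nhds (0 : ℝ) one_pos] with x hx
    rw [omegaF_one_of_abs_le]
    simpa using (mem_ball_zero_iff.1 hx).le
  · have : ContinuousAt (fun x ↦ (1 - max 0 (min 1 (2 - |x|))) / x) l := by
      fun_prop (disch := exact hl)
    refine this.congr ?_
    filter_upwards [isOpen_ne.mem_nhds hl] with x hx
    simp only [omegaF, trapF_one_eq, if_neg hx]

/-- The almost-everywhere derivative of `omegaF 1`. -/
noncomputable def omegaDeriv (l : ℝ) : ℝ :=
  if |l| ≤ 1 then 0 else if |l| ≤ 2 then (l ^ 2)⁻¹ else -(l ^ 2)⁻¹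

theorem hasDerivAt_omegaF_one {l : ℝ} (hl : l ∉ ({1, -1, 2, -2} : Set ℝ)) :
    HasDerivAt (omegaF 1) (omegaDeriv l) l := by
  have h1 : |l| ≠ 1 := fun h ↦ hl (by rcases eq_or_eq_neg_of_abs_eq h with h | h <;> simp [h])
  have h2 : |l| ≠ 2 := fun h ↦ hl (by rcases eq_or_eq_neg_of_abs_eq h with h | h <;> simp [h])
  rcases h1.lt_or_gt with h | h
  · rw [omegaDeriv, if_pos h.le]
    refine (hasDerivAt_const l (0 : ℝ)).congr_of_eventuallyEq ?_
    filter_upwards [(isOpen_lt continuous_abs continuous_const).mem_nhds h] with x hx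
    exact omegaF_one_of_abs_le (le_of_lt hx)
  have hl0 : l ≠ 0 := by rintro rfl; simp at h; linarith
  rw [omegaDeriv, if_neg h.not_ge]
  rcases h2.lt_or_gt with h' | h'
  · rw [if_pos h'.le]
    have key : HasDerivAt (fun x ↦ ((SignType.sign l : SignType) : ℝ) - x⁻¹) ((l ^ 2)⁻¹) l := by
      simpa using (hasDerivAt_inv hl0).const_sub (SignType.sign l : ℝ)
    refine key.congr_of_eventuallyEq ?_
    rcases hl0.lt_or_gt with h0 | h0
    · rw [abs_of_neg h0] at h h'
      filter_upwards [Ioo_mem_nhds (show -2 < l by linarith) (show l < -1 by linarith)] with x hx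
      have hx0 : x < 0 := by linarith [hx.2]
      simp only [omegaF, trapF, abs_of_neg hx0, hx0.ne, if_false, sign_neg h0]
      rw [if_neg (by linarith [hx.2]), if_pos (by linarith [hx.1])]
      have hx0' := hx0.ne
      simp only [SignType.coe_neg_one]
      field_simp
      ring
    · rw [abs_of_pos h0] at h h'
      filter_upwards [Ioo_mem_nhds h h'] with x hx
      have hx0 : 0 < x := by linarith [hx.1]
      simp only [omegaF, trapF, abs_of_pos hx0, hx0.ne', if_false, sign_pos h0]
      rw [if_neg (by linarith [hx.1]), if_pos (by linarith [hx.2])]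
      simp only [SignType.coe_one]
      field_simp
      ring
  · rw [if_neg h'.not_ge]
    refine (hasDerivAt_inv hl0).congr_of_eventuallyEq ?_
    filter_upwards [(isOpen_lt continuous_const continuous_abs).mem_nhds h'] with x hx
    have hx : 2 < |x| := hx
    have hx0 : x ≠ 0 := by rintro rfl; simp at hx; linarith
    simp only [omegaF, trapF, if_neg hx0]
    rw [if_neg (by linarith), if_neg (by linarith)]
    simp

theorem sq_omegaF_one_le (l : ℝ) :
    omegaF 1 l ^ 2 ≤ (Ioi 1).indicator (fun y : ℝ ↦ y ^ (-2 : ℝ)) |l| := by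
  rcases le_or_gt |l| 1 with h | h
  · simp [omegaF_one_of_abs_le h, h]
  · have h0 : l ≠ 0 := by rintro rfl; simp at h; linarith
    rw [indicator_of_mem (by exact h), rpow_neg (abs_nonneg l), rpow_two, sq_abs, omegaF, if_neg h0,
      trapF_one_eq, div_pow, div_eq_mul_inv]
    refine mul_le_of_le_one_left (by positivity) (pow_le_one₀ ?_ ?_)
    · exact sub_nonneg.2 (max_le zero_le_one (min_le_left _ _))
    · linarith [le_max_left 0 (min 1 (2 - |l|))]

theorem sq_omegaDeriv_eq (l : ℝ) :
    omegaDeriv l ^ 2 = (Ioi 1).indicator (fun y : ℝ ↦ y ^ (-4 : ℝ)) |l| := by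
  rcases le_or_gt |l| 1 with h | h
  · simp [omegaDeriv, h]
  · rw [indicator_of_mem (by exact h), rpow_neg (abs_nonneg l), omegaDeriv, if_neg h.not_ge]
    have : |l| ^ (4 : ℝ) = (l ^ 2) ^ 2 := by
      rw [← sq_abs l, ← pow_mul]; exact_mod_cast rpow_natCast |l| 4
    rw [this]
    split_ifs <;> simp

theorem measurable_omegaDeriv : Measurable omegaDeriv := by
  unfold omegaDeriv
  refine Measurable.ite (measurableSet_le (by fun_prop) (by fun_prop)) (by fun_prop)
    (Measurable.ite (measurableSet_le (by fun_prop) (by fun_prop)) (by fun_prop) (by fun_prop))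

theorem integral_indicator_rpow_abs {s : ℝ} (hs : s < -1) :
    (Integrable fun l : ℝ ↦ (Ioi 1).indicator (fun y : ℝ ↦ y ^ s) |l|) ∧
    ∫ l : ℝ, (Ioi 1).indicator (fun y : ℝ ↦ y ^ s) |l| = 2 * (-1 / (s + 1)) := by
  have h2 : ∫ l : ℝ, (Ioi 1).indicator (fun y : ℝ ↦ y ^ s) |l| = 2 * (-1 / (s + 1)) := by
    rw [integral_comp_abs, integral_indicator measurableSet_Ioi,
      Measure.restrict_restrict measurableSet_Ioi, inter_eq_left.2 (Ioi_subset_Ioi zero_le_one),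
      integral_Ioi_rpow_of_lt hs one_pos, one_rpow]
  refine ⟨.of_integral_ne_zero ?_, h2⟩
  rw [h2]
  have : s + 1 < 0 := by linarith
  exact mul_ne_zero two_ne_zero (div_ne_zero (by norm_num) this.ne)

theorem exists_integrable_fourier_eq_omegaF_one :
    ∃ g : ℝ → ℂ, Integrable g ∧ 𝓕 g = (fun l ↦ (omegaF 1 l : ℂ)) ∧ ∫ x, ‖g x‖ ≤ 13 / 12 := by
  obtain ⟨hi₂, he₂⟩ := integral_indicator_rpow_abs (s := -2) (by norm_num)
  obtain ⟨hi₄, he₄⟩ := integral_indicator_rpow_abs (s := -4) (by norm_num)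
  have hc : Continuous fun l ↦ (omegaF 1 l : ℂ) :=
    Complex.continuous_ofReal.comp continuous_omegaF_one
  have hsq (y : ℝ) : ‖(y : ℂ)‖ ^ 2 = y ^ 2 := by simp
  have hw : Integrable fun l ↦ ‖(omegaF 1 l : ℂ)‖ ^ 2 := by
    refine hi₂.mono' (hc.norm.pow 2).aestronglyMeasurable (.of_forall fun l ↦ ?_)
    rw [norm_of_nonneg (by positivity), hsq]
    exact sq_omegaF_one_le l
  have hv : ∀ l, ‖(omegaDeriv l : ℂ)‖ ^ 2 = (Ioi 1).indicator (fun y : ℝ ↦ y ^ (-4 : ℝ)) |l| :=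
    fun l ↦ by rw [hsq, sq_omegaDeriv_eq]
  have hw₂ : MemLp (fun l ↦ (omegaF 1 l : ℂ)) 2 :=
    (memLp_two_iff_integrable_sq_norm hc.aestronglyMeasurable).2 hw
  have hv₂ : MemLp (fun l ↦ (omegaDeriv l : ℂ)) 2 :=
    (memLp_two_iff_integrable_sq_norm
      (Complex.measurable_ofReal.comp measurable_omegaDeriv).aestronglyMeasurable).2
      (by simpa only [Function.comp_apply, hv] using hi₄)
  have hbound (l : ℝ) : ‖(omegaF 1 l : ℂ)‖ ≤ 1 := by
    refine (sq_le_one_iff₀ (norm_nonneg _)).1 ?_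
    rw [hsq]
    refine (sq_omegaF_one_le l).trans (indicator_apply_le' (fun h ↦ ?_) fun _ ↦ zero_le_one)
    exact rpow_le_one_of_one_le_of_nonpos (le_of_lt h) (by norm_num)
  obtain ⟨g, hgi, hg, hgn⟩ := exists_integrable_fourier_eq hc hw₂ hv₂
    (integral_schwartz_mul_deriv hc hw₂ hv₂ hbound
      (s := {1, -1, 2, -2}) (Set.toFinite _).countable
      fun x hx ↦ (hasDerivAt_omegaF_one hx).ofReal_comp)
    (p := 1 / 3) (r := 3 * π) (by norm_num) (by positivity)
  refine ⟨g, hgi, hg, hgn.trans ?_⟩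
  have h₂ : ∫ l, ‖(omegaF 1 l : ℂ)‖ ^ 2 ≤ 2 := by
    refine (integral_mono hw hi₂ fun l ↦ ?_).trans (by rw [he₂]; norm_num)
    simpa only [hsq] using sq_omegaF_one_le l
  have h₄ : ∫ l, ‖(omegaDeriv l : ℂ)‖ ^ 2 = 2 / 3 := by
    simp only [hv, he₄]
    norm_num
  have e₁ : 1 / 3 * (3 * π) ^ 2 / (2 * π) ^ 2 = 3 / 4 := by
    field_simp
    norm_num
  have e₂ : π / (1 / 3 * (3 * π)) = 1 := by
    field_simp
  rw [h₄, e₁, e₂]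
  linarith

theorem le_two_mul_rpow_one_sub_log_two :
    (13 : ℝ) / 12 ≤ 2 * (2 * (1 - Real.log 2) / 3) ^ ((1 : ℝ) / 4) := by
  have h : (13 / 24 : ℝ) ≤ (2 * (1 - Real.log 2) / 3) ^ ((1 : ℝ) / 4) := by
    rw [one_div, le_rpow_inv_iff_of_pos (by norm_num) (by linarith [log_two_lt_d9]) (by norm_num)]
    have : (13 / 24 : ℝ) ^ (4 : ℝ) = (13 / 24) ^ 4 := by exact_mod_cast rpow_natCast (13 / 24 : ℝ) 4
    rw [this]
    norm_num
    linarith [log_two_lt_d9]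
  linarith

end

/-- For every `a > 0` there is `ψ_a ∈ L¹(ℝ, ℂ)` with Fourier transform `ω_a` and
`‖ψ_a‖₁ ≤ (2/a)·(2(1 − ln 2)/3)^{1/4} ≤ 1.35/a` (the estimate (2.9) of the paper). -/
theorem stmt7 (a : ℝ) (ha : 0 < a) :
    ∃ ψ : ℝ → ℂ, Integrable ψ volume ∧
      (∀ l : ℝ, (∫ t : ℝ, ψ t * Complex.exp (-(Complex.I * l * t))) = (omegaF a l : ℂ)) ∧
      (∫ t : ℝ, ‖ψ t‖) ≤ (2 / a) * (2 * (1 - Real.log 2) / 3) ^ ((1 : ℝ) / 4) ∧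
      (∫ t : ℝ, ‖ψ t‖) ≤ 1.35 / a := by
  obtain ⟨g, hgi, hg, hgn⟩ := exists_integrable_fourier_eq_omegaF_one
  have hπ := Real.pi_pos
  have hk : a / (2 * Real.pi) ≠ 0 := by positivity
  have hnorm : ∫ t : ℝ, ‖((2 * Real.pi : ℝ) : ℂ)⁻¹ * g (a / (2 * Real.pi) * t)‖
      = (∫ x, ‖g x‖) / a := by
    simp only [norm_mul]
    rw [integral_const_mul, Measure.integral_comp_mul_left (fun x ↦ ‖g x‖),
      abs_of_pos (by positivity)]
    simp only [norm_inv, Complex.norm_real, Real.norm_eq_abs, smul_eq_mul,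
      abs_of_pos (show 0 < 2 * Real.pi by positivity)]
    field_simp
  have hle : (∫ x, ‖g x‖) / a ≤ 13 / 12 / a := by gcongr
  refine ⟨fun t ↦ ((2 * Real.pi : ℝ) : ℂ)⁻¹ * g (a / (2 * Real.pi) * t),
    (hgi.comp_mul_left' hk).const_mul _, fun l ↦ ?_, ?_, ?_⟩
  · have h := congrFun hg (l / a)
    rw [Real.fourier_real_eq_integral_exp_smul] at h
    have e (t : ℝ) : ((2 * Real.pi : ℝ) : ℂ)⁻¹ * g (a / (2 * Real.pi) * t)
        * Complex.exp (-(Complex.I * l * t)) = ((2 * Real.pi : ℝ) : ℂ)⁻¹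
        * (Complex.exp (((-2 * Real.pi * (a / (2 * Real.pi) * t) * (l / a) : ℝ) : ℂ) * Complex.I)
          • g (a / (2 * Real.pi) * t)) := by
      have : -2 * Real.pi * (a / (2 * Real.pi) * t) * (l / a) = -(l * t) := by
        field_simp
      have : ((-2 * Real.pi * (a / (2 * Real.pi) * t) * (l / a) : ℝ) : ℂ) * Complex.I
          = -(Complex.I * l * t) := by
        rw [this]
        push_cast
        ring
      rw [this, smul_eq_mul]
      ring
    simp only [e]
    rw [integral_const_mul, Measure.integral_comp_mul_left (fun x : ℝ ↦
      Complex.exp (((-2 * Real.pi * x * (l / a) : ℝ) : ℂ) * Complex.I) • g x), h,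
      abs_of_pos (by positivity)]
    have hl : omegaF a l = omegaF 1 (l / a) / a := by
      rw [← omegaF_mul_left ha, mul_div_cancel₀ l ha.ne']
    rw [hl, Complex.real_smul]
    push_cast
    have hπ' : (Real.pi : ℂ) ≠ 0 := by exact_mod_cast hπ.ne'
    have ha' : (a : ℂ) ≠ 0 := by exact_mod_cast ha.ne'
    field_simp
  · rw [hnorm]
    refine hle.trans ?_
    rw [div_mul_eq_mul_div]
    gcongr
    exact le_two_mul_rpow_one_sub_log_two
  · rw [hnorm]
    refine hle.trans ?_
    gcongr
    norm_num
end

section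
/- For every b > 0 there exists a function ψ ∈ L¹(ℝ, ℂ) such that ∫_ℝ ψ(t)·e^{−iλt} dt = 1/(|λ − 2b| + 2b) for every λ ∈ ℝ, and ‖ψ‖₁ = 1/(2b). (This is the key step of the paper's Lemma 2.17, proved via Pólya's criterion: λ ↦ 2b/(|λ| + 2b) is even, convex on ℝ₊, equal to 1 at 0 and tending to 0 at infinity, hence it is the Fourier transform of a nonnegative integrable function of total mass 1.) -/
open MeasureTheory

section PoissonKernel

open scoped FourierTransform
open Real Set

/-- The Poisson kernel of the upper half-plane, i.e. the centred Cauchy density of scale `x`. -/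
noncomputable def halfPlanePoissonKernel (x t : ℝ) : ℝ := π⁻¹ * x * (t ^ 2 + x ^ 2)⁻¹

lemma measurable_uncurry_halfPlanePoissonKernel :
    Measurable (Function.uncurry halfPlanePoissonKernel) := by
  unfold halfPlanePoissonKernel Function.uncurry
  fun_prop

lemma halfPlanePoissonKernel_nonneg {x : ℝ} (hx : 0 ≤ x) (t : ℝ) :
    0 ≤ halfPlanePoissonKernel x t := by
  unfold halfPlanePoissonKernel
  positivity

lemma halfPlanePoissonKernel_eq_cauchyPDFReal {x : ℝ} (hx : 0 ≤ x) :
    halfPlanePoissonKernel x = ProbabilityTheory.cauchyPDFReal 0 ⟨x, hx⟩ := by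
  ext t
  simp [halfPlanePoissonKernel, ProbabilityTheory.cauchyPDFReal]
  rfl

lemma integrable_halfPlanePoissonKernel {x : ℝ} (hx : 0 ≤ x) :
    Integrable (halfPlanePoissonKernel x) := by
  rw [halfPlanePoissonKernel_eq_cauchyPDFReal hx]
  exact ProbabilityTheory.integrable_cauchyPDFReal 0

lemma integral_halfPlanePoissonKernel {x : ℝ} (hx : 0 < x) :
    ∫ t, halfPlanePoissonKernel x t = 1 := by
  rw [halfPlanePoissonKernel_eq_cauchyPDFReal hx.le]
  exact ProbabilityTheory.integral_cauchyPDFReal_eq_one 0 fun h ↦ hx.ne' (congrArg NNReal.toReal h)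

lemma integrable_exp_neg_mul_abs {c : ℝ} (hc : 0 < c) :
    Integrable fun v : ℝ ↦ (rexp (-c * |v|) : ℂ) := by
  refine Integrable.ofReal (f := fun v : ℝ ↦ rexp (-c * |v|)) ?_
  rw [← integrableOn_univ, ← Iic_union_Ioi (a := (0 : ℝ))]
  refine IntegrableOn.union ?_ ?_
  · refine (integrableOn_exp_mul_Iic hc 0).congr_fun (fun v hv ↦ ?_) measurableSet_Iic
    simp [abs_of_nonpos (mem_Iic.1 hv)]
  · refine (integrableOn_exp_mul_Ioi (neg_lt_zero.2 hc) 0).congr_fun (fun v hv ↦ ?_)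
      measurableSet_Ioi
    simp [abs_of_pos (mem_Ioi.1 hv)]

lemma fourier_exp_neg_mul_abs {x : ℝ} (hx : 0 < x) (w : ℝ) :
    𝓕 (fun v : ℝ ↦ (rexp (-(2 * π * x) * |v|) : ℂ)) w = halfPlanePoissonKernel x w := by
  have hc : 0 < 2 * π * x := by positivity
  have hint : Integrable fun v : ℝ ↦
      Complex.exp (↑(-2 * π * v * w) * Complex.I) • (rexp (-(2 * π * x) * |v|) : ℂ) := by
    refine (integrable_exp_neg_mul_abs hc).mono (by fun_prop) (.of_forall fun v ↦ ?_)
    rw [norm_smul, Complex.norm_exp_ofReal_mul_I, one_mul]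
  have hneg : ∫ v in Iic (0 : ℝ),
      Complex.exp (↑(-2 * π * v * w) * Complex.I) • (rexp (-(2 * π * x) * |v|) : ℂ)
      = ∫ v in Iic (0 : ℝ), Complex.exp ((2 * π * (x - w * Complex.I)) * v) := by
    refine setIntegral_congr_fun measurableSet_Iic fun v hv ↦ ?_
    simp only [abs_of_nonpos (mem_Iic.1 hv), smul_eq_mul, Complex.ofReal_exp, ← Complex.exp_add]
    congr 1
    push_cast
    ring
  have hpos : ∫ v in Ioi (0 : ℝ),
      Complex.exp (↑(-2 * π * v * w) * Complex.I) • (rexp (-(2 * π * x) * |v|) : ℂ)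
      = ∫ v in Ioi (0 : ℝ), Complex.exp ((-(2 * π * (x + w * Complex.I))) * v) := by
    refine setIntegral_congr_fun measurableSet_Ioi fun v hv ↦ ?_
    simp only [abs_of_pos (mem_Ioi.1 hv), smul_eq_mul, Complex.ofReal_exp, ← Complex.exp_add]
    congr 1
    push_cast
    ring
  rw [fourier_real_eq_integral_exp_smul,
    ← intervalIntegral.integral_Iic_add_Ioi (b := 0) hint.integrableOn hint.integrableOn,
    hneg, hpos, integral_exp_mul_complex_Iic (by simpa using hc),
    integral_exp_mul_complex_Ioi (by simpa using hc)]
  have hπ : (π : ℂ) ≠ 0 := by exact_mod_cast pi_ne_zero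
  have h1 : (x : ℂ) - w * Complex.I ≠ 0 := fun h ↦ hx.ne' (by simpa using congrArg Complex.re h)
  have h2 : (x : ℂ) + w * Complex.I ≠ 0 := fun h ↦ hx.ne' (by simpa using congrArg Complex.re h)
  have h3 : (w : ℂ) ^ 2 + x ^ 2 = (x - w * Complex.I) * (x + w * Complex.I) := by
    linear_combination (w : ℂ) ^ 2 * Complex.I_sq
  simp only [halfPlanePoissonKernel]
  push_cast
  rw [h3]
  simp only [mul_zero, Complex.exp_zero]
  field_simp
  ring

lemma integral_halfPlanePoissonKernel_mul_exp {x : ℝ} (hx : 0 < x) (m : ℝ) :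
    ∫ t : ℝ, (halfPlanePoissonKernel x t : ℂ) * Complex.exp (-(Complex.I * m * t))
      = rexp (-x * |m|) := by
  have hF : 𝓕 (fun v : ℝ ↦ (rexp (-(2 * π * x) * |v|) : ℂ))
      = fun w ↦ (halfPlanePoissonKernel x w : ℂ) := funext (fourier_exp_neg_mul_abs hx)
  have hinv := congrFun (Continuous.fourierInv_fourier_eq
    (f := fun v : ℝ ↦ (rexp (-(2 * π * x) * |v|) : ℂ)) (by fun_prop)
    (integrable_exp_neg_mul_abs (by positivity))
    (hF ▸ (integrable_halfPlanePoissonKernel hx.le).ofReal)) (-m / (2 * π))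
  rw [hF, fourierInv_eq'] at hinv
  have hπ : (π : ℂ) ≠ 0 := by exact_mod_cast pi_ne_zero
  convert hinv using 1
  · congr 1
    ext t
    rw [smul_eq_mul, mul_comm]
    congr 2
    simp
    field_simp
  · congr 2
    rw [abs_div, abs_neg, abs_of_pos (by positivity : 0 < 2 * π)]
    field_simp

/-- The Laplace transform, in the scale parameter, of the Poisson kernel. -/
noncomputable def laplacePoissonKernel (a t : ℝ) : ℝ :=
  ∫ x in Ioi (0 : ℝ), rexp (-a * x) * halfPlanePoissonKernel x t

lemma laplacePoissonKernel_nonneg (a t : ℝ) : 0 ≤ laplacePoissonKernel a t :=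
  setIntegral_nonneg measurableSet_Ioi fun _ hx ↦
    mul_nonneg (exp_pos _).le (halfPlanePoissonKernel_nonneg (mem_Ioi.1 hx).le t)

lemma integrable_exp_mul_halfPlanePoissonKernel {a : ℝ} (ha : 0 < a) :
    Integrable (fun p : ℝ × ℝ ↦ rexp (-a * p.1) * halfPlanePoissonKernel p.1 p.2)
      ((volume.restrict (Ioi 0)).prod volume) := by
  have hmeas : Measurable fun p : ℝ × ℝ ↦ rexp (-a * p.1) * halfPlanePoissonKernel p.1 p.2 :=
    Measurable.mul (by fun_prop) measurable_uncurry_halfPlanePoissonKernel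
  refine (integrable_prod_iff hmeas.aestronglyMeasurable).2 ⟨?_, ?_⟩
  · filter_upwards [ae_restrict_mem measurableSet_Ioi] with x hx
    exact (integrable_halfPlanePoissonKernel (mem_Ioi.1 hx).le).const_mul _
  · refine (integrableOn_exp_mul_Ioi (neg_lt_zero.2 ha) 0).congr_fun (fun x hx ↦ ?_)
      measurableSet_Ioi
    have hx : 0 < x := hx
    simp only [norm_mul, norm_of_nonneg (exp_pos _).le,
      norm_of_nonneg (halfPlanePoissonKernel_nonneg hx.le _)]
    rw [integral_const_mul, integral_halfPlanePoissonKernel hx, mul_one]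

lemma integrable_laplacePoissonKernel {a : ℝ} (ha : 0 < a) :
    Integrable (laplacePoissonKernel a) :=
  (integrable_exp_mul_halfPlanePoissonKernel ha).integral_prod_right

lemma integral_laplacePoissonKernel_mul_exp {a : ℝ} (ha : 0 < a) (m : ℝ) :
    ∫ t : ℝ, (laplacePoissonKernel a t : ℂ) * Complex.exp (-(Complex.I * m * t))
      = ((|m| + a : ℝ) : ℂ)⁻¹ := by
  have hint : Integrable (Function.uncurry fun x t : ℝ ↦
      ((rexp (-a * x) * halfPlanePoissonKernel x t : ℝ) : ℂ)
        * Complex.exp (-(Complex.I * m * t)))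
      ((volume.restrict (Ioi 0)).prod volume) := by
    have h := (integrable_exp_mul_halfPlanePoissonKernel ha).ofReal (𝕜 := ℂ)
    refine h.mono (h.aestronglyMeasurable.mul (by fun_prop)) (.of_forall fun p ↦ ?_)
    simp [Function.uncurry, Complex.norm_exp]
  calc ∫ t : ℝ, (laplacePoissonKernel a t : ℂ) * Complex.exp (-(Complex.I * m * t))
      = ∫ t : ℝ, ∫ x in Ioi (0 : ℝ), ((rexp (-a * x) * halfPlanePoissonKernel x t : ℝ) : ℂ)
          * Complex.exp (-(Complex.I * m * t)) := by
        simp only [laplacePoissonKernel, ← integral_complex_ofReal, integral_mul_const]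
    _ = ∫ x in Ioi (0 : ℝ), ∫ t : ℝ, ((rexp (-a * x) * halfPlanePoissonKernel x t : ℝ) : ℂ)
          * Complex.exp (-(Complex.I * m * t)) := (integral_integral_swap hint).symm
    _ = ∫ x in Ioi (0 : ℝ), ((rexp (-(|m| + a) * x) : ℝ) : ℂ) := by
        refine setIntegral_congr_fun measurableSet_Ioi fun x hx ↦ ?_
        simp only [Complex.ofReal_mul, mul_assoc]
        rw [integral_const_mul]
        simp only [← mul_assoc]
        rw [integral_halfPlanePoissonKernel_mul_exp hx, ← Complex.ofReal_mul, ← Real.exp_add]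
        congr 2
        ring
    _ = ((|m| + a : ℝ) : ℂ)⁻¹ := by
        have hneg : -(|m| + a) < 0 := by linarith [abs_nonneg m]
        rw [integral_complex_ofReal, integral_exp_mul_Ioi hneg]
        simp [neg_div_neg_eq, -neg_add_rev]

lemma integral_laplacePoissonKernel {a : ℝ} (ha : 0 < a) :
    ∫ t, laplacePoissonKernel a t = a⁻¹ := by
  have h := integral_laplacePoissonKernel_mul_exp ha 0
  simp only [Complex.ofReal_zero, mul_zero, zero_mul, neg_zero, Complex.exp_zero, mul_one,
    abs_zero, zero_add, integral_complex_ofReal] at h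
  exact_mod_cast h

end PoissonKernel

/-- The key step of the paper's Lemma 2.17, via Pólya's criterion: for every `b > 0`
there is `ψ ∈ L¹(ℝ, ℂ)` whose Fourier transform is `λ ↦ 1/(|λ − 2b| + 2b)` and whose
`L¹` norm is exactly `1/(2b)`. -/
theorem stmt8 (b : ℝ) (hb : 0 < b) :
    ∃ ψ : ℝ → ℂ, Integrable ψ volume ∧
      (∀ l : ℝ, (∫ t : ℝ, ψ t * Complex.exp (-(Complex.I * l * t)))
        = ((|l - 2 * b| + 2 * b : ℝ) : ℂ)⁻¹) ∧
      (∫ t : ℝ, ‖ψ t‖) = 1 / (2 * b) := by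
  have ha : 0 < 2 * b := by positivity
  have hnorm (t : ℝ) : ‖(laplacePoissonKernel (2 * b) t : ℂ)
      * Complex.exp (Complex.I * (2 * b : ℝ) * t)‖ = laplacePoissonKernel (2 * b) t := by
    simp [Complex.norm_exp, abs_of_nonneg (laplacePoissonKernel_nonneg (2 * b) t)]
  refine ⟨fun t ↦ laplacePoissonKernel (2 * b) t * Complex.exp (Complex.I * (2 * b : ℝ) * t),
    ?_, fun l ↦ ?_, ?_⟩
  · have h := (integrable_laplacePoissonKernel ha).ofReal (𝕜 := ℂ)
    refine (integrable_laplacePoissonKernel ha).mono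
      (h.aestronglyMeasurable.mul (by fun_prop)) (.of_forall fun t ↦ ?_)
    rw [hnorm]
    exact le_abs_self _
  · rw [← integral_laplacePoissonKernel_mul_exp ha]
    congr 1
    ext t
    rw [mul_assoc, ← Complex.exp_add]
    congr 2
    push_cast
    ring
  · simp only [hnorm, integral_laplacePoissonKernel ha, one_div]
end

section
/- Let B be an arbitrary bounded linear operator on X. Then there exist N ∈ ℕ, a bounded operator B₀ on X whose matrix is banded, i.e. P_i B₀ P_j = 0 whenever |i − j| > N, and a bounded operator U on X with bounded inverse such that U(D(A)) = D(A) and (A − B)(Ux) = U(Ax − B₀x) for all x ∈ D(A); that is, A − B is similar to the operator A − B₀ with banded matrix. (Theorem 6.3 of the paper.) -/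
open MeasureTheory Filter Topology AddCircle

section Fourier

variable {T : ℝ}

/-- The Fejér kernel `N⁻¹ |∑_{0 ≤ k < N} e_k|²`, written as a trigonometric polynomial. -/
noncomputable def fejerKernel (T : ℝ) (N : ℕ) (z : AddCircle T) : ℂ :=
  (N : ℂ)⁻¹ * ∑ k ∈ Finset.Ico (0 : ℤ) N, ∑ l ∈ Finset.Ico (0 : ℤ) N, fourier (k - l) z

theorem continuous_fejerKernel (N : ℕ) : Continuous (fejerKernel T N) := by
  unfold fejerKernel
  fun_prop

theorem fejerKernel_eq (N : ℕ) (z : AddCircle T) :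
    fejerKernel T N z =
      (((N : ℝ)⁻¹ * ‖∑ k ∈ Finset.Ico (0 : ℤ) N, (fourier k z : ℂ)‖ ^ 2 : ℝ) : ℂ) := by
  push_cast
  rw [← Complex.mul_conj', map_sum, Finset.sum_mul_sum]
  simp_rw [← fourier_neg, ← fourier_add, ← sub_eq_add_neg]
  rfl

variable [Fact (0 < T)]

theorem integrable_of_continuous_addCircle {E : Type*} [NormedAddCommGroup E]
    {f : AddCircle T → E} (hf : Continuous f) : Integrable f haarAddCircle :=
  hf.integrable_of_hasCompactSupport (HasCompactSupport.of_compactSpace f)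

theorem fourierCoeff_fejerKernel (N : ℕ) (n : ℤ) :
    fourierCoeff (fejerKernel T N) n = (N : ℂ)⁻¹ * ((N - |n|).toNat : ℂ) := by
  have hint : ∀ m : ℤ, Integrable (fun z : AddCircle T => (fourier m z : ℂ)) haarAddCircle :=
    fun m => integrable_of_continuous_addCircle (by fun_prop)
  have h1 : fejerKernel T N = fun z => (N : ℂ)⁻¹ *
      (∑ k ∈ Finset.Ico (0 : ℤ) N, ∑ l ∈ Finset.Ico (0 : ℤ) N,
        fun z : AddCircle T => (fourier (k - l) z : ℂ)) z := by
    ext z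
    simp [fejerKernel, Finset.sum_apply]
  rw [h1, fourierCoeff.const_mul, fourierCoeff.sum _ _ (fun k _ => by
    exact integrable_finsetSum' _ fun l _ => hint _)]
  congr 1
  have h2 : ∀ k ∈ Finset.Ico (0 : ℤ) N, fourierCoeff (∑ l ∈ Finset.Ico (0 : ℤ) N,
      fun z : AddCircle T => (fourier (k - l) z : ℂ)) n =
      if k - n ∈ Finset.Ico (0 : ℤ) N then 1 else 0 := by
    intro k _
    rw [fourierCoeff.sum _ _ (fun l _ => hint _), Finset.sum_apply]
    simp_rw [fourierCoeff_fourier]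
    simp_rw [Pi.single_apply, show ∀ l : ℤ, n = k - l ↔ k - n = l by omega]
    exact Finset.sum_ite_eq _ _ _
  rw [Finset.sum_apply, Finset.sum_congr rfl h2, Finset.sum_boole]
  have h3 : (Finset.Ico (0 : ℤ) N).filter (fun k => k - n ∈ Finset.Ico (0 : ℤ) N) =
      Finset.Ico (max 0 n) (min N (N + n)) := by
    ext k
    simp only [Finset.mem_filter, Finset.mem_Ico]
    omega
  rw [h3, Int.card_Ico]
  congr 2
  rcases abs_cases n with ⟨h, _⟩ | ⟨h, _⟩ <;> rw [h] <;> omega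

theorem integral_norm_fejerKernel {N : ℕ} (hN : N ≠ 0) :
    ∫ z, ‖fejerKernel T N z‖ ∂haarAddCircle = 1 := by
  have h0 := fourierCoeff_fejerKernel (T := T) N 0
  have h1 : ∀ z : AddCircle T, fejerKernel T N z = (‖fejerKernel T N z‖ : ℂ) := by
    intro z
    rw [fejerKernel_eq, Complex.norm_of_nonneg (by positivity)]
  simp only [fourierCoeff, neg_zero, fourier_zero, one_smul] at h0
  rw [integral_congr_ae (Eventually.of_forall h1), integral_complex_ofReal] at h0
  have : (N : ℂ) ≠ 0 := by exact_mod_cast hN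
  simpa [this] using h0

theorem norm_one_sub_fourierCoeff_fejerKernel_le {N : ℕ} (hN : N ≠ 0) (n : ℤ) :
    ‖1 - fourierCoeff (fejerKernel T N) n‖ ≤ min 1 ((|n| : ℝ) / N) := by
  have hN' : (0 : ℝ) < N := by positivity
  have h : (1 : ℂ) - fourierCoeff (fejerKernel T N) n =
      ((1 - (N : ℝ)⁻¹ * ((N - |n|).toNat : ℝ) : ℝ) : ℂ) := by
    rw [fourierCoeff_fejerKernel]
    push_cast
    rfl
  have h1 : (((N - |n|).toNat : ℤ) : ℝ) ≤ N := by
    have : ((N - |n|).toNat : ℤ) ≤ N := by have := abs_nonneg n; omega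
    exact_mod_cast this
  have h2 : (N : ℝ) - |(n : ℝ)| ≤ (((N - |n|).toNat : ℤ) : ℝ) := by
    have : N - |n| ≤ ((N - |n|).toNat : ℤ) := Int.self_le_toNat _
    exact_mod_cast this
  rw [Int.cast_natCast] at h1 h2
  rw [h, Complex.norm_real, Real.norm_eq_abs, le_min_iff, abs_le, abs_le]
  have h3 : (N : ℝ)⁻¹ * ((N - |n|).toNat : ℝ) ≤ 1 := by
    rw [inv_mul_le_iff₀ hN']; linarith
  have h4 : 1 - |(n : ℝ)| / N ≤ (N : ℝ)⁻¹ * ((N - |n|).toNat : ℝ) := by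
    rw [← div_eq_inv_mul, one_sub_div hN'.ne']
    gcongr
  have h5 : 0 ≤ (N : ℝ)⁻¹ * ((N - |n|).toNat : ℝ) := by positivity
  have h6 : 0 ≤ |(n : ℝ)| / N := by positivity
  refine ⟨⟨?_, ?_⟩, ?_, ?_⟩ <;> linarith

theorem integral_norm_le_of_integral_norm_sq_le {f : AddCircle T → ℂ}
    (hf : MemLp f 2 haarAddCircle) {ε : ℝ} (hε : 0 < ε)
    (h : ∫ z, ‖f z‖ ^ 2 ∂haarAddCircle ≤ ε ^ 2) : ∫ z, ‖f z‖ ∂haarAddCircle ≤ ε := by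
  have hsq := hf.integrable_norm_pow (p := 2) (by norm_num)
  calc ∫ z, ‖f z‖ ∂haarAddCircle
      ≤ ∫ z, (ε / 2 + (2 * ε)⁻¹ * ‖f z‖ ^ 2) ∂haarAddCircle := by
        refine integral_mono (hf.integrable (by norm_num)).norm
          ((integrable_const _).add (hsq.const_mul _)) fun z => ?_
        have : ε / 2 + (2 * ε)⁻¹ * ‖f z‖ ^ 2 - ‖f z‖ = (2 * ε)⁻¹ * (‖f z‖ - ε) ^ 2 := by
          field_simp; ring
        have h' : 0 ≤ (2 * ε)⁻¹ * (‖f z‖ - ε) ^ 2 := by positivity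
        simp only
        linarith
    _ = ε / 2 + (2 * ε)⁻¹ * ∫ z, ‖f z‖ ^ 2 ∂haarAddCircle := by
        rw [integral_add (integrable_const _) (hsq.const_mul _), integral_const_mul]
        simp
    _ ≤ ε / 2 + (2 * ε)⁻¹ * ε ^ 2 := by gcongr
    _ = ε := by field_simp; ring

/-- An `L²` function with prescribed Fourier coefficients `c` of small `ℓ²` norm. -/
theorem exists_fourierCoeff_eq {c : ℤ → ℂ} (hc : Summable fun n => ‖c n‖ ^ 2) {ε : ℝ}
    (hε : 0 < ε) (h : ∑' n, ‖c n‖ ^ 2 ≤ ε ^ 2) :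
    ∃ f : AddCircle T → ℂ, Integrable f haarAddCircle ∧ ∫ z, ‖f z‖ ∂haarAddCircle ≤ ε ∧
      ∀ n, fourierCoeff f n = c n := by
  have hmem : Memℓp c 2 := memℓp_gen (by simpa using hc)
  set f := (fourierBasis (T := T)).repr.symm ⟨c, hmem⟩ with hf
  have hcoeff : ∀ n, fourierCoeff f n = c n := fun n => by
    rw [← fourierBasis_repr, hf, LinearIsometryEquiv.apply_symm_apply]
  refine ⟨f, (Lp.memLp f).integrable (by norm_num), ?_, hcoeff⟩
  refine integral_norm_le_of_integral_norm_sq_le (Lp.memLp f) hε ?_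
  rw [← tsum_sq_fourierCoeff]
  simpa only [hcoeff] using h

theorem tendsto_tsum_sq_one_sub_fourierCoeff_fejerKernel_div :
    Tendsto (fun N : ℕ => ∑' n : ℤ, ‖(1 - fourierCoeff (fejerKernel T (N + 1)) n) / n‖ ^ 2)
      atTop (𝓝 0) := by
  rw [← tsum_zero (α := ℝ) (β := ℤ) (L := .unconditional ℤ)]
  refine tendsto_tsum_of_dominated_convergence (bound := fun n : ℤ => 1 / (n : ℝ) ^ 2)
    (Real.summable_one_div_int_pow.mpr one_lt_two) (fun n => ?_)
    (Eventually.of_forall fun N n => ?_)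
  · have h1 : Tendsto (fun N : ℕ => (|n| : ℝ) / ((N + 1 : ℕ) : ℝ)) atTop (𝓝 0) :=
      (tendsto_const_div_atTop_nhds_zero_nat _).comp (tendsto_add_atTop_nat 1)
    have h2 : Tendsto (fun N : ℕ => 1 - fourierCoeff (fejerKernel T (N + 1)) n) atTop (𝓝 0) :=
      squeeze_zero_norm (fun N =>
        ((norm_one_sub_fourierCoeff_fejerKernel_le N.succ_ne_zero n).trans
          (min_le_right _ _)).trans_eq (by push_cast; rfl)) h1
    simpa using ((h2.div_const (n : ℂ)).norm).pow 2
  · have h := (norm_one_sub_fourierCoeff_fejerKernel_le (T := T) N.succ_ne_zero n).trans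
      (min_le_left _ _)
    rw [norm_div, Complex.norm_intCast, div_pow, sq_abs, Real.norm_of_nonneg (by positivity)]
    gcongr
    exact pow_le_one₀ (norm_nonneg _) h

/-- There are a trigonometric polynomial `φ` of `L¹` norm at most one and a function `f` of
arbitrarily small `L¹` norm such that `n f̂(n) = 1 - φ̂(n)` for all `n`. -/
theorem exists_fourier_smoothing {ε : ℝ} (hε : 0 < ε) :
    ∃ (N : ℕ) (φ f : AddCircle T → ℂ), Integrable φ haarAddCircle ∧ Integrable f haarAddCircle ∧
      ∫ z, ‖φ z‖ ∂haarAddCircle ≤ 1 ∧ ∫ z, ‖f z‖ ∂haarAddCircle ≤ ε ∧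
      (∀ n : ℤ, (N : ℤ) < |n| → fourierCoeff φ n = 0) ∧
      ∀ n : ℤ, n * fourierCoeff f n = 1 - fourierCoeff φ n := by
  obtain ⟨N, hN⟩ := ((tendsto_tsum_sq_one_sub_fourierCoeff_fejerKernel_div (T := T)).eventually
    (ge_mem_nhds (show (0 : ℝ) < ε ^ 2 by positivity))).exists
  have hle := norm_one_sub_fourierCoeff_fejerKernel_le (T := T) N.succ_ne_zero
  have hsum : Summable fun n : ℤ => ‖(1 - fourierCoeff (fejerKernel T (N + 1)) n) / n‖ ^ 2 := by
    refine (Real.summable_one_div_int_pow.mpr one_lt_two).of_nonneg_of_le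
      (fun n => by positivity) fun n => ?_
    rw [norm_div, Complex.norm_intCast, div_pow, sq_abs]
    gcongr
    exact pow_le_one₀ (norm_nonneg _) ((hle n).trans (min_le_left _ _))
  obtain ⟨f, hf, hfε, hfc⟩ := exists_fourierCoeff_eq (T := T) hsum hε hN
  refine ⟨N + 1, fejerKernel T (N + 1), f,
    integrable_of_continuous_addCircle (continuous_fejerKernel _), hf,
    (integral_norm_fejerKernel N.succ_ne_zero).le, hfε, fun n hn => ?_, fun n => ?_⟩
  · rw [fourierCoeff_fejerKernel, Int.toNat_of_nonpos (by omega)]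
    simp
  · rcases eq_or_ne n 0 with rfl | hn
    · have := (hle 0).trans (min_le_right _ _)
      simp only [Int.cast_zero, abs_zero, zero_div, norm_le_zero_iff] at this
      simp [this]
    · rw [hfc]
      field_simp

end Fourier

section FixedPoint

/-- The equation of the method of similar operators is solvable in a ball when `Γ` is small. -/
theorem exists_eq_add_mul_sub_mul {R : Type*} [NormedRing R] [CompleteSpace R]
    (Γ J : R →+ R) {γ β : ℝ} (hγ : 0 ≤ γ) (hΓ : ∀ m, ‖Γ m‖ ≤ γ * ‖m‖) (hJ : ∀ m, ‖J m‖ ≤ ‖m‖)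
    {b : R} (hβ : 0 < β) (hb : ‖b‖ ≤ β) (hsmall : 6 * (β * γ) ≤ 1) :
    ∃ m, ‖m‖ ≤ 2 * β ∧ m = b + b * Γ m - Γ m * J m := by
  have hΓ' : ∀ m, ‖m‖ ≤ 2 * β → ‖Γ m‖ ≤ 2 * (β * γ) := fun m hm =>
    (hΓ m).trans (by nlinarith)
  have hmaps : Set.MapsTo (fun m => b + b * Γ m - Γ m * J m)
      (Metric.closedBall 0 (2 * β)) (Metric.closedBall 0 (2 * β)) := by
    intro m hm
    rw [mem_closedBall_zero_iff] at hm ⊢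
    calc ‖b + b * Γ m - Γ m * J m‖ ≤ ‖b‖ + ‖b‖ * ‖Γ m‖ + ‖Γ m‖ * ‖J m‖ :=
          (norm_sub_le _ _).trans (add_le_add ((norm_add_le _ _).trans
            (by gcongr; exact norm_mul_le _ _)) (norm_mul_le _ _))
      _ ≤ β + β * (2 * (β * γ)) + 2 * (β * γ) * (2 * β) := by
          gcongr
          exacts [hΓ' m hm, hΓ' m hm, (hJ m).trans hm]
      _ ≤ 2 * β := by nlinarith
  have hcontr : ContractingWith (5 / 6)
      (hmaps.restrict (fun m => b + b * Γ m - Γ m * J m) _ _) := by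
    refine ⟨by rw [div_lt_one (by norm_num)]; norm_num, LipschitzWith.of_dist_le_mul ?_⟩
    rintro ⟨m, hm⟩ ⟨n, hn⟩
    rw [mem_closedBall_zero_iff] at hm hn
    simp only [Subtype.dist_eq, Set.MapsTo.val_restrict_apply, dist_eq_norm]
    have h : b + b * Γ m - Γ m * J m - (b + b * Γ n - Γ n * J n) =
        b * Γ (m - n) - Γ (m - n) * J m - Γ n * J (m - n) := by
      simp only [map_sub]; noncomm_ring
    rw [h]
    calc ‖b * Γ (m - n) - Γ (m - n) * J m - Γ n * J (m - n)‖
        ≤ ‖b‖ * ‖Γ (m - n)‖ + ‖Γ (m - n)‖ * ‖J m‖ + ‖Γ n‖ * ‖J (m - n)‖ :=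
          (norm_sub_le _ _).trans (add_le_add ((norm_sub_le _ _).trans
            (add_le_add (norm_mul_le _ _) (norm_mul_le _ _))) (norm_mul_le _ _))
      _ ≤ β * (γ * ‖m - n‖) + (γ * ‖m - n‖) * (2 * β) + 2 * (β * γ) * ‖m - n‖ := by
          gcongr
          exacts [hΓ _, hΓ _, (hJ m).trans hm, hΓ' n hn, hJ _]
      _ ≤ 5 / 6 * ‖m - n‖ := by nlinarith [norm_nonneg (m - n)]
  obtain ⟨m, hm, hfix, -⟩ := hcontr.exists_fixedPoint' Metric.isClosed_closedBall.isComplete hmaps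
    (Metric.mem_closedBall_self (by positivity)) (edist_ne_top _ _)
  exact ⟨m, mem_closedBall_zero_iff.1 hm, hfix.symm⟩

end FixedPoint

/-- If `‖L‖ < 1` and `L` preserves a closed subspace `G`, then `(1 + L) z ∈ G` forces `z ∈ G`. -/
theorem mem_of_add_apply_mem {E : Type*} [NormedAddCommGroup E] [NormedSpace ℂ E]
    {L : E →L[ℂ] E} (hL : ‖L‖ < 1) {G : Submodule ℂ E} (hG : IsClosed (G : Set E))
    (hLG : ∀ z ∈ G, L z ∈ G) {z : E} (hz : z + L z ∈ G) : z ∈ G := by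
  have hne : (G : Set E).Nonempty := ⟨0, G.zero_mem⟩
  have hle : Metric.infDist z G ≤ ‖L‖ * Metric.infDist z G := by
    refine le_of_forall_pos_le_add fun ε hε => ?_
    obtain ⟨g, hg, hgd⟩ := (Metric.infDist_lt_iff (x := z) hne).1 (lt_add_of_pos_right _ hε)
    calc Metric.infDist z G ≤ dist z (z + L z - L g) :=
          Metric.infDist_le_dist_of_mem (G.sub_mem hz (hLG g hg))
      _ = ‖L (z - g)‖ := by
          rw [dist_eq_norm, ← norm_neg, map_sub]; congr 1; abel
      _ ≤ ‖L‖ * dist z g := by rw [dist_eq_norm]; exact L.le_opNorm _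
      _ ≤ ‖L‖ * (Metric.infDist z G + ε) := by gcongr
      _ ≤ ‖L‖ * Metric.infDist z G + ε := by nlinarith [norm_nonneg L]
  have h0 : Metric.infDist z G = 0 :=
    le_antisymm (by nlinarith [Metric.infDist_nonneg (x := z) (s := (G : Set E))])
      Metric.infDist_nonneg
  exact (hG.mem_iff_infDist_zero hne).2 h0

section Resolution

variable {T : ℝ} {X : Type*} [NormedAddCommGroup X] [NormedSpace ℂ X]

/-- A disjunctive resolution of the identity `P` for which the operators
`x ↦ ∑ k, e_k(z) • P k x`, `z` in the circle of length `T`, are isometries. -/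
structure IsIsometricResolution (T : ℝ) (P : ℤ → X →L[ℂ] X) : Prop where
  apply_self : ∀ k x, P k (P k x) = P k x
  apply_of_ne : ∀ i j, i ≠ j → ∀ x, P i (P j x) = 0
  hasSum : ∀ x, HasSum (fun k => P k x) x
  summable_fourier : ∀ (z : AddCircle T) x, Summable fun k => (fourier k z : ℂ) • P k x
  norm_tsum_fourier : ∀ (z : AddCircle T) x, ‖∑' k, (fourier k z : ℂ) • P k x‖ = ‖x‖

namespace IsIsometricResolution

variable {P : ℤ → X →L[ℂ] X} (h : IsIsometricResolution T P)

include h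

theorem ext {x y : X} (hxy : ∀ k, P k x = P k y) : x = y :=
  (h.hasSum x).unique ((funext hxy : (fun k => P k x) = fun k => P k y) ▸ h.hasSum y)

theorem apply_tsum {a : ℤ → ℂ} {x : X} (hs : Summable fun k => a k • P k x) (k : ℤ) :
    P k (∑' j, a j • P j x) = a k • P k x := by
  rw [(P k).map_tsum hs, tsum_eq_single k fun j hj => by
    rw [map_smul, h.apply_of_ne k j hj.symm, smul_zero], map_smul, h.apply_self]

theorem summable_iff {x : X} {a : ℤ → ℂ} :
    (Summable fun k => a k • P k x) ↔ ∃ y, ∀ k, P k y = a k • P k x :=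
  ⟨fun hs => ⟨_, h.apply_tsum hs⟩, fun ⟨y, hy⟩ => by
    simpa only [hy] using (h.hasSum y).summable⟩

theorem tsum_eq {x y : X} {a : ℤ → ℂ} (hy : ∀ k, P k y = a k • P k x) :
    ∑' k, a k • P k x = y := by
  simpa only [hy] using (h.hasSum y).tsum_eq

theorem hasSum_apply_apply (M : X →L[ℂ] X) (i : ℤ) (x : X) :
    HasSum (fun j => P i (M (P j x))) (P i (M x)) :=
  (h.hasSum x).mapL ((P i).comp M)

theorem clm_ext {M M' : X →L[ℂ] X} (hM : ∀ i j x, P i (M (P j x)) = P i (M' (P j x))) :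
    M = M' := by
  ext x
  refine h.ext fun i => (h.hasSum_apply_apply M i x).unique ?_
  simpa only [hM] using h.hasSum_apply_apply M' i x

/-- The isometric group `∑ k, e_k(z) P k`. -/
noncomputable def rotation (z : AddCircle T) : X →ₗᵢ[ℂ] X where
  toFun x := ∑' k, (fourier k z : ℂ) • P k x
  map_add' x y := by
    simp_rw [map_add, smul_add]
    exact (h.summable_fourier z x).tsum_add (h.summable_fourier z y)
  map_smul' c x := by
    simp_rw [map_smul, smul_comm _ c]
    exact (h.summable_fourier z x).tsum_const_smul c
  norm_map' := h.norm_tsum_fourier z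

theorem apply_rotation (k : ℤ) (z : AddCircle T) (x : X) :
    P k (h.rotation z x) = (fourier k z : ℂ) • P k x :=
  h.apply_tsum (h.summable_fourier z x) k

theorem rotation_apply (k : ℤ) (z : AddCircle T) (x : X) :
    h.rotation z (P k x) = (fourier k z : ℂ) • P k x :=
  h.ext fun j => by
    rw [h.apply_rotation, map_smul]
    rcases eq_or_ne j k with rfl | hjk
    · rfl
    · simp [h.apply_of_ne j k hjk]

theorem continuous_rotation_apply (x : X) : Continuous fun z => h.rotation z x := by
  refine TendstoUniformly.continuous (p := (atTop : Filter (Finset ℤ)))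
    (F := fun s z => h.rotation z (∑ k ∈ s, P k x)) ?_ ?_
  · rw [Metric.tendstoUniformly_iff]
    intro ε hε
    filter_upwards [Metric.tendsto_nhds.1 (h.hasSum x) ε hε] with s hs z
    rwa [(h.rotation z).dist_map, dist_comm]
  · refine (Eventually.of_forall fun s => ?_).frequently
    simp_rw [map_sum, h.rotation_apply]
    fun_prop

theorem continuous_rotation : Continuous fun p : AddCircle T × X => h.rotation p.1 p.2 :=
  continuous_prod_of_continuous_lipschitzWith' _ 1 (fun z => (h.rotation z).lipschitz)
    h.continuous_rotation_apply

theorem continuous_conj_rotation (M : X →L[ℂ] X) (x : X) :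
    Continuous fun z => h.rotation (-z) (M (h.rotation z x)) :=
  h.continuous_rotation.comp (continuous_neg.prodMk
    (M.continuous.comp (h.continuous_rotation_apply x)))

theorem norm_conj_rotation_le (M : X →L[ℂ] X) (x : X) (z : AddCircle T) :
    ‖h.rotation (-z) (M (h.rotation z x))‖ ≤ ‖M‖ * ‖x‖ := by
  rw [LinearIsometry.norm_map]
  exact (M.le_opNorm _).trans_eq (by rw [LinearIsometry.norm_map])

theorem apply_conj_rotation (M : X →L[ℂ] X) (i j : ℤ) (x : X) (z : AddCircle T) :
    P i (h.rotation (-z) (M (h.rotation z (P j x)))) =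
      (fourier (-(i - j)) z : ℂ) • P i (M (P j x)) := by
  rw [h.apply_rotation, h.rotation_apply, map_smul, map_smul, smul_smul, neg_sub, sub_eq_neg_add,
    fourier_add]
  simp only [fourier_apply, smul_neg, neg_smul]

/-- If `C` is the formal commutator of the generator `A = ∑ k P k` with `K`, then `K` preserves
`D(A)` and `A K = K A + C` there. -/
theorem apply_add_apply_eq {K C : X →L[ℂ] X}
    (hKC : ∀ (i j : ℤ) x, ((i : ℂ) - j) • P i (K (P j x)) = P i (C (P j x))) {x y : X}
    (hy : ∀ k : ℤ, P k y = (k : ℂ) • P k x) (k : ℤ) :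
    P k (K y + C x) = (k : ℂ) • P k (K x) := by
  rw [map_add]
  refine ((h.hasSum_apply_apply K k y).add (h.hasSum_apply_apply C k x)).unique ?_
  convert! (h.hasSum_apply_apply K k x).const_smul (k : ℂ) using 2 with j
  rw [hy, ← hKC, map_smul, map_smul, ← add_smul, add_sub_cancel]

/-- If moreover `‖K‖ < 1`, then `x + K x ∈ D(A)` implies `x ∈ D(A)`. -/
theorem exists_generator_of_add {K V C : X →L[ℂ] X} (hK : ‖K‖ < 1)
    (hV : ∀ x, V x + K (V x) = x)
    (hKC : ∀ (i j : ℤ) x, ((i : ℂ) - j) • P i (K (P j x)) = P i (C (P j x))) {x w : X}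
    (hw : ∀ k : ℤ, P k w = (k : ℂ) • P k (x + K x)) :
    ∃ y, ∀ k : ℤ, P k y = (k : ℂ) • P k x := by
  -- Rescale the graph of the generator so that the block operator below becomes a contraction.
  obtain ⟨ε, hε, hlt⟩ : ∃ ε : ℝ, 0 < ε ∧ ‖K‖ + ε * ‖C‖ < 1 := by
    refine ⟨(1 - ‖K‖) / (‖C‖ + 1), div_pos (by linarith) (by positivity), ?_⟩
    have : (1 - ‖K‖) / (‖C‖ + 1) * ‖C‖ < 1 - ‖K‖ := by
      rw [div_mul_eq_mul_div, div_lt_iff₀ (by positivity)]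
      nlinarith
    linarith
  let G : Submodule ℂ (X × X) :=
    { carrier := {p | ∀ k : ℤ, P k p.2 = ((ε : ℂ) * k) • P k p.1}
      add_mem' := fun {p q} hp hq k => by
        simp only [Prod.fst_add, Prod.snd_add, map_add, smul_add, hp k, hq k]
      zero_mem' := fun k => by simp
      smul_mem' := fun c p hp k => by
        simp only [Prod.smul_fst, Prod.smul_snd, map_smul, hp k, smul_comm c] }
  have hG : IsClosed (G : Set (X × X)) := by
    change IsClosed {p : X × X | ∀ k : ℤ, P k p.2 = ((ε : ℂ) * k) • P k p.1}
    rw [Set.ofPred_forall]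
    exact isClosed_iInter fun k => isClosed_eq (by fun_prop) (by fun_prop)
  let L : X × X →L[ℂ] X × X :=
    (K.comp (.fst ℂ X X)).prod (K.comp (.snd ℂ X X) + (ε : ℂ) • C.comp (.fst ℂ X X))
  have hL : ‖L‖ < 1 := by
    refine lt_of_le_of_lt (L.opNorm_le_bound (by positivity) fun p => ?_) hlt
    have h1 := norm_fst_le p
    have h2 := norm_snd_le p
    refine max_le ?_ ?_
    · calc ‖K p.1‖ ≤ ‖K‖ * ‖p.1‖ := K.le_opNorm _
        _ ≤ (‖K‖ + ε * ‖C‖) * ‖p‖ := by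
          gcongr
          exact le_add_of_nonneg_right (by positivity)
    · calc ‖K p.2 + (ε : ℂ) • C p.1‖ ≤ ‖K‖ * ‖p.2‖ + ε * (‖C‖ * ‖p.1‖) := by
            refine (norm_add_le _ _).trans (add_le_add (K.le_opNorm _) ?_)
            rw [norm_smul, Complex.norm_of_nonneg hε.le]
            gcongr
            exact C.le_opNorm _
        _ ≤ ‖K‖ * ‖p‖ + ε * (‖C‖ * ‖p‖) := by gcongr
        _ = (‖K‖ + ε * ‖C‖) * ‖p‖ := by ring
  have hε' : (ε : ℂ) ≠ 0 := by exact_mod_cast hε.ne'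
  have hgraph : ∀ p : X × X, p ∈ G ↔ ∀ k : ℤ, P k ((ε : ℂ)⁻¹ • p.2) = (k : ℂ) • P k p.1 :=
    fun p => forall_congr' fun k => by rw [map_smul, inv_smul_eq_iff₀ hε', smul_smul]
  have hLG : ∀ p ∈ G, L p ∈ G := fun p hp => by
    rw [hgraph] at hp ⊢
    have hLp : (ε : ℂ)⁻¹ • (L p).2 = K ((ε : ℂ)⁻¹ • p.2) + C p.1 := by
      change (ε : ℂ)⁻¹ • (K p.2 + (ε : ℂ) • C p.1) = _
      rw [smul_add, inv_smul_smul₀ hε', map_smul]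
    rw [hLp]
    exact h.apply_add_apply_eq hKC hp
  have hmem : (x, V ((ε : ℂ) • (w - C x))) ∈ G := by
    refine mem_of_add_apply_mem hL hG hLG ((hgraph _).2 fun k => ?_)
    have hVx := hV ((ε : ℂ) • (w - C x))
    have : (ε : ℂ)⁻¹ • (V ((ε : ℂ) • (w - C x)) +
        (K (V ((ε : ℂ) • (w - C x))) + (ε : ℂ) • C x)) = w := by
      rw [← add_assoc, hVx, ← smul_add, sub_add_cancel, inv_smul_smul₀ hε']
    change P k ((ε : ℂ)⁻¹ • (V ((ε : ℂ) • (w - C x)) +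
      (K (V ((ε : ℂ) • (w - C x))) + (ε : ℂ) • C x))) = _
    rw [this]
    exact hw k
  exact ⟨_, (hgraph _).1 hmem⟩

variable [Fact (0 < T)]

theorem integrable_smul_conj_rotation {f : AddCircle T → ℂ} (hf : Integrable f haarAddCircle)
    (M : X →L[ℂ] X) (x : X) :
    Integrable (fun z => f z • h.rotation (-z) (M (h.rotation z x))) haarAddCircle :=
  hf.smul_bdd (‖M‖ * ‖x‖)
    (integrable_of_continuous_addCircle (h.continuous_conj_rotation M x)).aestronglyMeasurable
    (Eventually.of_forall (h.norm_conj_rotation_le M x))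

variable [CompleteSpace X]

/-- The average `∫ f(z) T(-z) M T(z) dz` has matrix entries `f̂(i - j) M_{ij}`. -/
theorem exists_average {f : AddCircle T → ℂ} (hf : Integrable f haarAddCircle) (M : X →L[ℂ] X) :
    ∃ S : X →L[ℂ] X, ‖S‖ ≤ (∫ z, ‖f z‖ ∂haarAddCircle) * ‖M‖ ∧
      ∀ i j x, P i (S (P j x)) = fourierCoeff f (i - j) • P i (M (P j x)) := by
  have hint := h.integrable_smul_conj_rotation hf M
  have hbound : ∀ x, ‖∫ z, f z • h.rotation (-z) (M (h.rotation z x)) ∂haarAddCircle‖ ≤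
      (∫ z, ‖f z‖ ∂haarAddCircle) * ‖M‖ * ‖x‖ := fun x => by
    rw [mul_assoc, ← integral_mul_const]
    refine norm_integral_le_of_norm_le (hf.norm.mul_const _) (Eventually.of_forall fun z => ?_)
    rw [norm_smul]
    gcongr
    exact h.norm_conj_rotation_le M x z
  refine ⟨LinearMap.mkContinuous
    { toFun := fun x => ∫ z, f z • h.rotation (-z) (M (h.rotation z x)) ∂haarAddCircle
      map_add' := fun x y => ?_
      map_smul' := fun c x => ?_ } _ hbound, LinearMap.mkContinuous_norm_le _ (by positivity) _,
    fun i j x => ?_⟩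
  · simp_rw [map_add, smul_add]
    exact integral_add (hint x) (hint y)
  · simp_rw [map_smul, smul_comm _ c]
    exact integral_smul c _
  · simp only [LinearMap.mkContinuous_apply, LinearMap.coe_mk, AddHom.coe_mk]
    rw [← (P i).integral_comp_comm (hint _)]
    simp_rw [map_smul, h.apply_conj_rotation, smul_smul]
    rw [integral_smul_const, fourierCoeff]
    simp_rw [smul_eq_mul, mul_comm]

theorem exists_schurMultiplier {f : AddCircle T → ℂ} (hf : Integrable f haarAddCircle) :
    ∃ Φ : (X →L[ℂ] X) →+ (X →L[ℂ] X),
      (∀ M, ‖Φ M‖ ≤ (∫ z, ‖f z‖ ∂haarAddCircle) * ‖M‖) ∧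
      ∀ M i j x, P i (Φ M (P j x)) = fourierCoeff f (i - j) • P i (M (P j x)) := by
  choose S hS hSP using h.exists_average hf
  refine ⟨AddMonoidHom.mk' S fun M M' => h.clm_ext fun i j x => ?_, hS, hSP⟩
  simp only [add_apply, map_add, hSP, smul_add]

end IsIsometricResolution

end Resolution

theorem isIsometricResolution_of_exp {X : Type*} [NormedAddCommGroup X] [NormedSpace ℂ X]
    (P : ℤ → X →L[ℂ] X)
    (hidem : ∀ k, (P k).comp (P k) = P k)
    (hdisj : ∀ i j, i ≠ j → (P i).comp (P j) = 0)
    (hsum : ∀ x : X, HasSum (fun k : ℤ => P k x) x)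
    (hT : ∀ t : ℝ, ∀ x : X,
      Summable (fun k : ℤ => Complex.exp (Complex.I * k * t) • P k x) ∧
      ‖∑' k : ℤ, Complex.exp (Complex.I * k * t) • P k x‖ = ‖x‖) :
    IsIsometricResolution (2 * Real.pi) P := by
  have key : ∀ (t : ℝ) (k : ℤ), (fourier k (t : AddCircle (2 * Real.pi)) : ℂ) =
      Complex.exp (Complex.I * k * t) := fun t k => by
    rw [fourier_coe_apply]
    congr 1
    have : (Real.pi : ℂ) ≠ 0 := by exact_mod_cast Real.pi_ne_zero
    push_cast
    field_simp
  refine ⟨fun k => DFunLike.congr_fun (hidem k), fun i j hij => DFunLike.congr_fun (hdisj i j hij),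
    hsum, fun z x => ?_, fun z x => ?_⟩
  · induction z using QuotientAddGroup.induction_on with
    | H t => simpa only [key] using (hT t x).1
  · induction z using QuotientAddGroup.induction_on with
    | H t => simpa only [key] using (hT t x).2

/-- Theorem 6.3 of the paper.  `X` is a complex Banach space, `(P k)_{k∈ℤ}` a disjunctive
resolution of the identity such that `T(t)x = Σ e^{ikt} P_k x` defines isometries, and
`A x = Σ k • P_k x` on the natural domain.  For every bounded operator `B` there are a
banded bounded operator `B₀` (i.e. `P_i B₀ P_j = 0` for `|i − j| > N`) and an invertible
bounded operator `U` preserving `D(A)` with `(A − B)(Ux) = U(Ax − B₀x)` on `D(A)`. -/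
theorem stmt9 {X : Type*} [NormedAddCommGroup X] [NormedSpace ℂ X] [CompleteSpace X]
    (P : ℤ → X →L[ℂ] X)
    (hidem : ∀ k, (P k).comp (P k) = P k)
    (hdisj : ∀ i j, i ≠ j → (P i).comp (P j) = 0)
    (hsum : ∀ x : X, HasSum (fun k : ℤ => P k x) x)
    (hT : ∀ t : ℝ, ∀ x : X,
      Summable (fun k : ℤ => Complex.exp (Complex.I * k * t) • P k x) ∧
      ‖∑' k : ℤ, Complex.exp (Complex.I * k * t) • P k x‖ = ‖x‖)
    (B : X →L[ℂ] X) :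
    ∃ (N : ℕ) (B₀ U V : X →L[ℂ] X),
      (∀ i j : ℤ, (N : ℤ) < |i - j| → (P i).comp (B₀.comp (P j)) = 0) ∧
      U.comp V = ContinuousLinearMap.id ℂ X ∧
      V.comp U = ContinuousLinearMap.id ℂ X ∧
      (∀ x : X, Summable (fun k : ℤ => (k : ℂ) • P k x) ↔
        Summable (fun k : ℤ => (k : ℂ) • P k (U x))) ∧
      (∀ x : X, Summable (fun k : ℤ => (k : ℂ) • P k x) →
        (∑' k : ℤ, (k : ℂ) • P k (U x)) - B (U x)
          = U ((∑' k : ℤ, (k : ℂ) • P k x) - B₀ x)) := by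
  have h := isIsometricResolution_of_exp P hidem hdisj hsum hT
  have : Fact (0 < 2 * Real.pi) := ⟨Real.two_pi_pos⟩
  have hβ : 0 < ‖B‖ + 1 := by positivity
  obtain ⟨N, φ, f, hφ, hf, hφ1, hfγ, hband, hcoeff⟩ :=
    exists_fourier_smoothing (T := 2 * Real.pi)
      (show 0 < (6 * (‖B‖ + 1))⁻¹ by positivity)
  obtain ⟨J, hJ, hJP⟩ := h.exists_schurMultiplier hφ
  obtain ⟨Γ, hΓ, hΓP⟩ := h.exists_schurMultiplier hf
  obtain ⟨M, hM, hMeq⟩ := exists_eq_add_mul_sub_mul Γ J (b := B) (by positivity)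
    (fun m => (hΓ m).trans (mul_le_mul_of_nonneg_right hfγ (norm_nonneg m)))
    (fun m => (hJ m).trans (mul_le_of_le_one_left (norm_nonneg m) hφ1)) hβ (by linarith)
    (by rw [mul_inv]; field_simp; norm_num)
  have hK : ‖Γ M‖ < 1 := by
    calc ‖Γ M‖ ≤ (6 * (‖B‖ + 1))⁻¹ * (2 * (‖B‖ + 1)) := (hΓ M).trans (by gcongr)
      _ = 1 / 3 := by field_simp; norm_num
      _ < 1 := by norm_num
  have hKC : ∀ (i j : ℤ) x, ((i : ℂ) - j) • P i (Γ M (P j x)) = P i ((M - J M) (P j x)) := by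
    intro i j x
    have hc := hcoeff (i - j)
    push_cast at hc
    rw [hΓP, smul_smul, hc, sub_apply, map_sub, hJP, sub_smul, one_smul]
  obtain ⟨u, hu⟩ := isUnit_one_sub_of_norm_lt_one (x := -Γ M) (by rwa [norm_neg])
  have hU : ∀ x, (u : X →L[ℂ] X) x = x + Γ M x := fun x => by simp [hu]
  have hV : ∀ x, (↑u⁻¹ : X →L[ℂ] X) x + Γ M ((↑u⁻¹ : X →L[ℂ] X) x) = x := fun x => by
    rw [← hU]
    exact DFunLike.congr_fun u.mul_inv x
  have hgen : ∀ x y, (∀ k : ℤ, P k y = (k : ℂ) • P k x) →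
      ∀ k : ℤ, P k (y + (Γ M y + (M - J M) x)) = (k : ℂ) • P k ((u : X →L[ℂ] X) x) := by
    intro x y hy k
    rw [hU, map_add, hy, h.apply_add_apply_eq hKC hy, map_add, smul_add]
  refine ⟨N, J M, u, ↑u⁻¹, fun i j hij => ?_, u.mul_inv, u.inv_mul, fun x => ?_, fun x hx => ?_⟩
  · ext x
    simp [hJP, hband _ hij]
  · rw [h.summable_iff, h.summable_iff]
    refine ⟨fun ⟨y, hy⟩ => ⟨_, hgen x y hy⟩, fun ⟨w, hw⟩ => ?_⟩
    simp_rw [hU] at hw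
    exact h.exists_generator_of_add hK hV hKC hw
  · obtain ⟨y, hy⟩ := h.summable_iff.1 hx
    rw [h.tsum_eq hy, h.tsum_eq (hgen x y hy)]
    have hMx := DFunLike.congr_fun hMeq x
    simp only [add_apply, sub_apply, mul_apply_eq_comp] at hMx
    simp only [hU, sub_apply, map_add, map_sub]
    nth_rewrite 1 [hMx]
    abel
end

section
/- Let B be a bounded linear operator on X with 10.8·√3·‖B‖ < 1. Then there exist a bounded operator B₀ on X whose matrix is diagonal, i.e. P_i B₀ P_j = 0 for all i ≠ j, and a bounded operator U on X with bounded inverse such that U(D(A)) = D(A) and (A − B)(Ux) = U(Ax − B₀x) for all x ∈ D(A); that is, A − B is similar to the operator A − B₀ with diagonal matrix. (Theorem 6.4 of the paper.) -/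
/-- The matrix of `W` with respect to `(P k)` is that of the commutator of `Σ k • P k` with `S`. -/
def HasCommutator {X : Type*} [NormedAddCommGroup X] [NormedSpace ℂ X]
    (P : ℤ → X →L[ℂ] X) (S W : X →L[ℂ] X) : Prop :=
  ∀ (k j : ℤ) (x : X), ((k : ℂ) - j) • P k (S (P j x)) = P k (W (P j x))

namespace HasCommutator

variable {X : Type*} [NormedAddCommGroup X] [NormedSpace ℂ X] {P : ℤ → X →L[ℂ] X}

/-- An operator with a bounded commutator preserves the domain of `Σ k • P k`. -/
theorem hasSum {S W : X →L[ℂ] X} (h : HasCommutator P S W)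
    (hsum : ∀ x : X, HasSum (fun k : ℤ => P k x) x) {x : X}
    (hx : Summable (fun k : ℤ => (k : ℂ) • P k x)) :
    HasSum (fun k : ℤ => (k : ℂ) • P k (S x)) (S (∑' k : ℤ, (k : ℂ) • P k x) + W x) := by
  have key (k : ℤ) :
      (k : ℂ) • P k (S x) = P k (S (∑' k : ℤ, (k : ℂ) • P k x) + W x) := by
    have h1 : HasSum (fun j : ℤ => (k : ℂ) • P k (S (P j x))) ((k : ℂ) • P k (S x)) :=
      (((hsum x).mapL S).mapL (P k)).const_smul _
    have h2 := ((hx.hasSum.mapL S).mapL (P k)).add (((hsum x).mapL W).mapL (P k))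
    rw [← map_add] at h2
    refine h1.unique (h2.congr_fun fun j => ?_)
    simp only [map_smul, ← h k j x, sub_smul]
    abel
  simpa only [key] using hsum _

theorem mul {S W S' W' : X →L[ℂ] X} (h : HasCommutator P S W) (h' : HasCommutator P S' W')
    (hsum : ∀ x : X, HasSum (fun k : ℤ => P k x) x) :
    HasCommutator P (S * S') (W * S' + S * W') := by
  intro k j x
  have h1 : HasSum (fun l : ℤ => ((k : ℂ) - j) • P k (S (P l (S' (P j x)))))
      (((k : ℂ) - j) • P k (S (S' (P j x)))) :=
    (((hsum (S' (P j x))).mapL S).mapL (P k)).const_smul _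
  have h2 := (((hsum (S' (P j x))).mapL W).mapL (P k)).add
    (((hsum (W' (P j x))).mapL S).mapL (P k))
  rw [← map_add] at h2
  refine h1.unique (h2.congr_fun fun l => ?_)
  simp only [← h k l, ← h' l j, map_smul, ← add_smul]
  congr 1
  ring

theorem one (hdisj : ∀ i j, i ≠ j → (P i).comp (P j) = 0) :
    HasCommutator P (1 : X →L[ℂ] X) 0 := by
  intro k j x
  rcases eq_or_ne k j with rfl | hkj
  · simp
  · simpa using Or.inr (DFunLike.congr_fun (hdisj k j hkj) x)

theorem sub {S W S' W' : X →L[ℂ] X} (h : HasCommutator P S W) (h' : HasCommutator P S' W') :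
    HasCommutator P (S - S') (W - W') := by
  intro k j x
  simp [smul_sub, h k j x, h' k j x]

theorem of_tendsto {S W : ℕ → X →L[ℂ] X} {S' W' : X →L[ℂ] X}
    (h : ∀ n, HasCommutator P (S n) (W n)) (hS : Filter.Tendsto S Filter.atTop (nhds S'))
    (hW : Filter.Tendsto W Filter.atTop (nhds W')) : HasCommutator P S' W' := by
  intro k j x
  have lim {F : ℕ → X →L[ℂ] X} {F' : X →L[ℂ] X}
      (hF : Filter.Tendsto F Filter.atTop (nhds F')) :
      Filter.Tendsto (fun n => P k (F n (P j x))) Filter.atTop (nhds (P k (F' (P j x)))) :=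
    ((P k).continuous.tendsto _).comp
      (((ContinuousLinearMap.apply ℂ X (P j x)).continuous.tendsto F').comp hF)
  refine tendsto_nhds_unique ((lim hS).const_smul ((k : ℂ) - j)) ?_
  simpa only [h _ k j x] using lim hW

/-- Operators with bounded commutators are closed under inverting `1 + S` for `‖S‖ < 1`. -/
theorem inverse {S W V : X →L[ℂ] X} (h : HasCommutator P S W)
    (hsum : ∀ x : X, HasSum (fun k : ℤ => P k x) x)
    (hdisj : ∀ i j, i ≠ j → (P i).comp (P j) = 0)
    (hS : ‖S‖ < 1) (hV : (1 + S) * V = 1) :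
    ∃ Z, HasCommutator P V Z := by
  let step : (X →L[ℂ] X) × (X →L[ℂ] X) → (X →L[ℂ] X) × (X →L[ℂ] X) :=
    fun p => (1 - S * p.1, 0 - (W * p.1 + S * p.2))
  let F : ℕ → (X →L[ℂ] X) × (X →L[ℂ] X) := fun n => step^[n] (1, 0)
  have hF (n : ℕ) : F (n + 1) = step (F n) := Function.iterate_succ_apply' _ _ _
  have hcomm (n : ℕ) : HasCommutator P (F n).1 (F n).2 := by
    induction n with
    | zero => exact one hdisj
    | succ n ih =>
      rw [hF]
      exact (one hdisj).sub (h.mul ih hsum)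
  obtain ⟨r, hSr, hr1⟩ := exists_between hS
  have hr0 : 0 < r := (norm_nonneg S).trans_lt hSr
  let Z : X →L[ℂ] X := -(V * (W * V))
  have hVS : V = 1 - S * V := by
    rw [← hV]
    noncomm_ring
  have hZS : Z = 0 - (W * V + S * Z) := by
    have : (1 + S) * Z = -(W * V) := by
      rw [mul_neg, ← mul_assoc, hV, one_mul]
    rw [add_mul, one_mul] at this
    rw [sub_add_eq_sub_sub, zero_sub]
    exact eq_sub_of_add_eq this
  have hfst (n : ℕ) : (F (n + 1)).1 - V = -(S * ((F n).1 - V)) := by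
    rw [hF]
    nth_rewrite 1 [hVS]
    simp only [step, mul_sub]
    abel
  have hsnd (n : ℕ) :
      (F (n + 1)).2 - Z = -(W * ((F n).1 - V) + S * ((F n).2 - Z)) := by
    rw [hF]
    nth_rewrite 1 [hZS]
    simp only [step, mul_sub]
    abel
  set d := ‖(F 0).1 - V‖
  set e := ‖(F 0).2 - Z‖
  have hfst_le (n : ℕ) : ‖(F n).1 - V‖ ≤ r ^ n * d := by
    induction n with
    | zero => simp [d]
    | succ n ih =>
      rw [hfst, norm_neg, pow_succ', mul_assoc]
      exact (norm_mul_le _ _).trans (by gcongr)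
  have hsnd_le (n : ℕ) :
      ‖(F n).2 - Z‖ ≤ r ^ n * e + n * r ^ n * (‖W‖ * d / r) := by
    induction n with
    | zero => simp [e]
    | succ n ih =>
      rw [hsnd, norm_neg]
      calc _ ≤ ‖W‖ * ‖(F n).1 - V‖ + ‖S‖ * ‖(F n).2 - Z‖ :=
            (norm_add_le _ _).trans (add_le_add (norm_mul_le _ _) (norm_mul_le _ _))
        _ ≤ ‖W‖ * (r ^ n * d) + r * (r ^ n * e + n * r ^ n * (‖W‖ * d / r)) := by
            gcongr
            exact hfst_le n
        _ = _ := by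
            push_cast
            field_simp
            ring
  have hpow := tendsto_pow_atTop_nhds_zero_of_lt_one hr0.le hr1
  refine ⟨Z, of_tendsto hcomm (tendsto_iff_norm_sub_tendsto_zero.2 ?_)
    (tendsto_iff_norm_sub_tendsto_zero.2 ?_)⟩
  · exact squeeze_zero (fun _ => norm_nonneg _) hfst_le (by simpa using hpow.mul_const d)
  · refine squeeze_zero (fun _ => norm_nonneg _) hsnd_le ?_
    simpa using (hpow.mul_const e).add
      ((tendsto_self_mul_const_pow_of_lt_one hr0.le hr1).mul_const (‖W‖ * d / r))

end HasCommutator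

open Complex in
/-- The isometries `T(t)` form a strongly continuous family diagonal with respect to `(P k)`. -/
theorem exists_isometric_group {X : Type*} [NormedAddCommGroup X] [NormedSpace ℂ X]
    (P : ℤ → X →L[ℂ] X)
    (hidem : ∀ k, (P k).comp (P k) = P k)
    (hdisj : ∀ i j, i ≠ j → (P i).comp (P j) = 0)
    (hsum : ∀ x : X, HasSum (fun k : ℤ => P k x) x)
    (hT : ∀ t : ℝ, ∀ x : X,
      Summable (fun k : ℤ => exp (I * k * t) • P k x) ∧
      ‖∑' k : ℤ, exp (I * k * t) • P k x‖ = ‖x‖) :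
    ∃ T : ℝ → X →L[ℂ] X, (∀ t x, ‖T t x‖ = ‖x‖) ∧ (∀ x, Continuous fun t => T t x) ∧
      (∀ t k x, P k (T t x) = exp (I * k * t) • P k x) ∧
      (∀ t k x, T t (P k x) = exp (I * k * t) • P k x) := by
  have hPP (i j : ℤ) (x : X) : P i (P j x) = if i = j then P j x else 0 := by
    split_ifs with hij
    · subst hij
      exact DFunLike.congr_fun (hidem i) x
    · exact DFunLike.congr_fun (hdisj i j hij) x
  let L (t : ℝ) : X →ₗᵢ[ℂ] X :=
    { toFun := fun x => ∑' k : ℤ, exp (I * k * t) • P k x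
      map_add' := fun x y => by
        simp only [map_add, smul_add]
        exact (hT t x).1.tsum_add (hT t y).1
      map_smul' := fun c x => by
        simp only [map_smul, RingHom.id_apply, smul_comm _ c]
        exact (hT t x).1.tsum_const_smul c
      norm_map' := fun x => (hT t x).2 }
  have hLP (t : ℝ) (k : ℤ) (x : X) : L t (P k x) = exp (I * k * t) • P k x := by
    change ∑' i : ℤ, exp (I * i * t) • P i (P k x) = _
    rw [tsum_eq_single k]
    · simp [hPP]
    · intro i hi
      simp [hPP, hi]
  refine ⟨fun t => (L t).toContinuousLinearMap, fun t x => (L t).norm_map x, fun x => ?_,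
    fun t k x => ?_, hLP⟩
  · have hlim : TendstoUniformly (fun (s : Finset ℤ) (t : ℝ) => L t (∑ k ∈ s, P k x))
        (fun t => L t x) Filter.atTop := by
      rw [Metric.tendstoUniformly_iff]
      intro ε hε
      filter_upwards [Metric.tendsto_nhds.1 (hsum x) ε hε] with s hs t
      rwa [(L t).dist_map, dist_comm]
    refine hlim.continuous (Filter.Frequently.of_forall fun s => ?_)
    simp only [map_sum, hLP]
    fun_prop
  · have h := (hT t x).1.hasSum.mapL (P k)
    refine h.unique ?_
    convert hasSum_ite_eq k (exp (I * k * t) • P k x) using 2 with i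
    rw [map_smul, hPP]
    by_cases hik : i = k
    · simp [hik]
    · simp [hik, Ne.symm hik]

open Complex in
/-- Averaging `T(t) B T(-t)` against `f` multiplies matrix entries by Fourier coefficients. -/
theorem exists_schur_multiplier {X : Type*} [NormedAddCommGroup X] [NormedSpace ℂ X]
    [CompleteSpace X] (P : ℤ → X →L[ℂ] X) (T : ℝ → X →L[ℂ] X)
    (hnorm : ∀ t x, ‖T t x‖ = ‖x‖) (hcont : ∀ x, Continuous fun t => T t x)
    (hPT : ∀ t k x, P k (T t x) = exp (I * k * t) • P k x)
    (hTP : ∀ t k x, T t (P k x) = exp (I * k * t) • P k x)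
    {f : ℝ → ℂ} (hf : Continuous f) {g : ℝ → ℝ} (hg : Continuous g) (hfg : ∀ t, ‖f t‖ ≤ g t) :
    ∃ Φ : (X →L[ℂ] X) →ₗ[ℂ] (X →L[ℂ] X),
      (∀ B, ‖Φ B‖ ≤ (∫ t in (0 : ℝ)..2 * Real.pi, g t) * ‖B‖) ∧
      ∀ (B : X →L[ℂ] X) (k j : ℤ) (x : X), P k (Φ B (P j x)) =
        (∫ t in (0 : ℝ)..2 * Real.pi, f t * exp ((k - j) * I * t)) • P k (B (P j x)) := by
  have hjoint (B : X →L[ℂ] X) (x : X) : Continuous fun t => f t • T t (B (T (-t) x)) := by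
    refine hf.smul (continuous_iff_continuousAt.2 fun s => ?_)
    let u (t : ℝ) := B (T (-t) x)
    have hu : Continuous u := B.continuous.comp ((hcont x).comp continuous_neg)
    change Filter.Tendsto (fun t => T t (u t)) (nhds s) (nhds (T s (u s)))
    have h1 : Filter.Tendsto (fun t => T t (u t - u s)) (nhds s) (nhds 0) := by
      rw [tendsto_zero_iff_norm_tendsto_zero]
      simpa only [hnorm] using tendsto_iff_norm_sub_tendsto_zero.1 (hu.tendsto s)
    simpa using h1.add ((hcont (u s)).tendsto s)
  have hintegrable (B : X →L[ℂ] X) (x : X) :=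
    (hjoint B x).intervalIntegrable (μ := MeasureTheory.volume) 0 (2 * Real.pi)
  let G : (X →L[ℂ] X) →ₗ[ℂ] X →ₗ[ℂ] X :=
    LinearMap.mk₂ ℂ (fun B x => ∫ t in (0 : ℝ)..2 * Real.pi, f t • T t (B (T (-t) x)))
      (fun B C x => by
        simp only [add_apply, map_add, smul_add]
        exact intervalIntegral.integral_add (hintegrable B x) (hintegrable C x))
      (fun c B x => by
        simp only [smul_apply, map_smul, smul_comm _ c]
        exact intervalIntegral.integral_smul _ _)
      (fun B x y => by
        simp only [map_add, smul_add]
        exact intervalIntegral.integral_add (hintegrable B x) (hintegrable B y))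
      (fun c B x => by
        simp only [map_smul, smul_comm _ c]
        exact intervalIntegral.integral_smul _ _)
  have hG (B : X →L[ℂ] X) (x : X) :
      ‖G B x‖ ≤ (∫ t in (0 : ℝ)..2 * Real.pi, g t) * ‖B‖ * ‖x‖ := by
    calc ‖G B x‖ ≤ ∫ t in (0 : ℝ)..2 * Real.pi, g t * (‖B‖ * ‖x‖) := by
          refine intervalIntegral.norm_integral_le_of_norm_le Real.two_pi_pos.le
            (Filter.Eventually.of_forall fun t _ => ?_)
            ((hg.mul continuous_const).intervalIntegrable _ _)
          rw [norm_smul, hnorm]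
          refine mul_le_mul (hfg t) ?_ (norm_nonneg _) ((norm_nonneg _).trans (hfg t))
          simpa only [hnorm] using B.le_opNorm (T (-t) x)
      _ = _ := by rw [intervalIntegral.integral_mul_const, mul_assoc]
  have hg0 : 0 ≤ ∫ t in (0 : ℝ)..2 * Real.pi, g t :=
    intervalIntegral.integral_nonneg Real.two_pi_pos.le
      fun t _ => (norm_nonneg _).trans (hfg t)
  refine ⟨(LinearMap.mkContinuous₂ G _ hG).toLinearMap, fun B => ?_, fun B k j x => ?_⟩
  · exact ContinuousLinearMap.opNorm_le_bound _ (mul_nonneg hg0 (norm_nonneg _)) (hG B)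
  · change P k (∫ t in (0 : ℝ)..2 * Real.pi, f t • T t (B (T (-t) (P j x)))) = _
    rw [← (P k).intervalIntegral_comp_comm (hintegrable B _), ← intervalIntegral.integral_smul_const]
    congr 1
    ext t
    rw [map_smul, hPT, hTP, map_smul, map_smul, smul_smul, smul_smul, mul_assoc, ← exp_add]
    congr 3
    push_cast
    ring

open Complex in
theorem integral_exp_int_mul (n : ℤ) :
    ∫ t in (0 : ℝ)..2 * Real.pi, (2 * Real.pi : ℂ)⁻¹ * exp (n * I * t) =
      if n = 0 then 1 else 0 := by
  have hpi : (Real.pi : ℂ) ≠ 0 := by exact_mod_cast Real.pi_ne_zero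
  rw [intervalIntegral.integral_const_mul]
  split_ifs with hn
  · simp [hn]
    field_simp
  · have hc : (n : ℂ) * I ≠ 0 := mul_ne_zero (by exact_mod_cast hn) I_ne_zero
    rw [integral_exp_mul_complex hc]
    have : (n : ℂ) * I * ((2 * Real.pi : ℝ) : ℂ) = n * (2 * Real.pi * I) := by push_cast; ring
    rw [this, exp_int_mul_two_pi_mul_I]
    simp

open Complex in
theorem int_mul_integral_sawtooth_mul_exp (n : ℤ) :
    n * ∫ t in (0 : ℝ)..2 * Real.pi,
      (2 * Real.pi : ℂ)⁻¹ * (-I * (Real.pi - t)) * exp (n * I * t) =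
      if n = 0 then 0 else 1 := by
  have hpi : (Real.pi : ℂ) ≠ 0 := by exact_mod_cast Real.pi_ne_zero
  split_ifs with hn
  · simp [hn]
  · have hn' : (n : ℂ) ≠ 0 := by exact_mod_cast hn
    have hder (t : ℝ) (_ : t ∈ Set.uIcc (0 : ℝ) (2 * Real.pi)) :
        HasDerivAt (fun t : ℝ => (2 * Real.pi : ℂ)⁻¹ *
          ((t - Real.pi + I / n) / n) * exp (n * I * t))
          ((2 * Real.pi : ℂ)⁻¹ * (-I * (Real.pi - t)) * exp (n * I * t)) t := by
      have h1 : HasDerivAt (fun t : ℝ => (t : ℂ)) 1 t := ofRealCLM.hasDerivAt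
      refine (((((h1.sub_const (Real.pi : ℂ)).add_const (I / n)).div_const (n : ℂ)).const_mul
        ((2 * Real.pi : ℂ)⁻¹)).mul (h1.const_mul ((n : ℂ) * I)).cexp).congr_deriv ?_
      field_simp
      ring_nf
      simp only [I_sq]
      ring
    rw [intervalIntegral.integral_eq_sub_of_hasDerivAt hder
      ((by fun_prop : Continuous _).intervalIntegrable _ _)]
    have : (n : ℂ) * I * ((2 * Real.pi : ℝ) : ℂ) = n * (2 * Real.pi * I) := by push_cast; ring
    rw [this, exp_int_mul_two_pi_mul_I]
    push_cast
    simp only [mul_zero, exp_zero, mul_one]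
    field_simp
    ring

/-- The fixed point equation of the method of similar operators. -/
theorem exists_fixedPoint_similar {X : Type*} [NormedAddCommGroup X] [NormedSpace ℂ X]
    [CompleteSpace X] (J Γ : (X →L[ℂ] X) →ₗ[ℂ] (X →L[ℂ] X))
    (hJ : ∀ S, ‖J S‖ ≤ ‖S‖) (hΓ : ∀ S, ‖Γ S‖ ≤ 2 * ‖S‖)
    (B : X →L[ℂ] X) (hB : 14 * ‖B‖ < 1) :
    ∃ Y : X →L[ℂ] X, Y = B + B * Γ Y - Γ Y * J Y ∧ ‖Y‖ ≤ 3 * ‖B‖ := by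
  let Φ (Y : X →L[ℂ] X) : X →L[ℂ] X := B + B * Γ Y - Γ Y * J Y
  set b := ‖B‖
  have hb : 0 ≤ b := norm_nonneg B
  let s := Metric.closedBall (0 : X →L[ℂ] X) (3 * b)
  have hmaps : Set.MapsTo Φ s s := by
    intro Y hY
    rw [mem_closedBall_zero_iff] at hY ⊢
    have h1 : ‖Γ Y‖ ≤ 6 * b := by linarith [hΓ Y]
    have h2 : ‖J Y‖ ≤ 3 * b := (hJ Y).trans hY
    calc ‖Φ Y‖ ≤ ‖B‖ + ‖B‖ * ‖Γ Y‖ + ‖Γ Y‖ * ‖J Y‖ :=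
          (norm_sub_le _ _).trans (add_le_add ((norm_add_le _ _).trans
            (add_le_add le_rfl (norm_mul_le _ _))) (norm_mul_le _ _))
      _ ≤ b + b * (6 * b) + 6 * b * (3 * b) := by gcongr
      _ ≤ 3 * b := by nlinarith
  have hlip : LipschitzOnWith (14 * ‖B‖₊) Φ s := by
    refine LipschitzOnWith.of_dist_le_mul fun Y hY Y' hY' => ?_
    rw [mem_closedBall_zero_iff] at hY hY'
    rw [dist_eq_norm, dist_eq_norm]
    have hd : Φ Y - Φ Y' = B * Γ (Y - Y') - (Γ (Y - Y') * J Y + Γ Y' * J (Y - Y')) := by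
      simp only [Φ, map_sub]
      noncomm_ring
    have h1 : ‖Γ Y'‖ ≤ 6 * b := by linarith [hΓ Y']
    have h2 : ‖J Y‖ ≤ 3 * b := (hJ Y).trans hY
    calc ‖Φ Y - Φ Y'‖
        ≤ ‖B‖ * ‖Γ (Y - Y')‖ + (‖Γ (Y - Y')‖ * ‖J Y‖ + ‖Γ Y'‖ * ‖J (Y - Y')‖) := by
          rw [hd]
          exact (norm_sub_le _ _).trans (add_le_add (norm_mul_le _ _) ((norm_add_le _ _).trans
            (add_le_add (norm_mul_le _ _) (norm_mul_le _ _))))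
      _ ≤ b * (2 * ‖Y - Y'‖) + (2 * ‖Y - Y'‖ * (3 * b) + 6 * b * ‖Y - Y'‖) := by
          gcongr
          exacts [hΓ _, hΓ _, hJ _]
      _ = 14 * b * ‖Y - Y'‖ := by ring
  have hcontr : ContractingWith (14 * ‖B‖₊) (hmaps.restrict Φ s s) :=
    ⟨by exact_mod_cast hB, hlip.mapsToRestrict hmaps⟩
  obtain ⟨Y, hY, hfix, -⟩ := hcontr.exists_fixedPoint' Metric.isClosed_closedBall.isComplete
    hmaps (Metric.mem_closedBall_self (by positivity : 0 ≤ 3 * b)) (edist_ne_top _ _)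
  exact ⟨Y, hfix.symm, mem_closedBall_zero_iff.1 hY⟩

/-- Theorem 6.4 of the paper.  In the setting of a disjunctive resolution of the identity
`(P k)_{k∈ℤ}` on a complex Banach space with isometries `T(t)x = Σ e^{ikt} P_k x` and
`A x = Σ k • P_k x`, if `10.8·√3·‖B‖ < 1` then `A − B` is similar to an operator
`A − B₀` whose matrix is diagonal (`P_i B₀ P_j = 0` for `i ≠ j`). -/
theorem stmt10 {X : Type*} [NormedAddCommGroup X] [NormedSpace ℂ X] [CompleteSpace X]
    (P : ℤ → X →L[ℂ] X)
    (hidem : ∀ k, (P k).comp (P k) = P k)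
    (hdisj : ∀ i j, i ≠ j → (P i).comp (P j) = 0)
    (hsum : ∀ x : X, HasSum (fun k : ℤ => P k x) x)
    (hT : ∀ t : ℝ, ∀ x : X,
      Summable (fun k : ℤ => Complex.exp (Complex.I * k * t) • P k x) ∧
      ‖∑' k : ℤ, Complex.exp (Complex.I * k * t) • P k x‖ = ‖x‖)
    (B : X →L[ℂ] X)
    (hB : 10.8 * Real.sqrt 3 * ‖B‖ < 1) :
    ∃ (B₀ U V : X →L[ℂ] X),
      (∀ i j : ℤ, i ≠ j → (P i).comp (B₀.comp (P j)) = 0) ∧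
      U.comp V = ContinuousLinearMap.id ℂ X ∧
      V.comp U = ContinuousLinearMap.id ℂ X ∧
      (∀ x : X, Summable (fun k : ℤ => (k : ℂ) • P k x) ↔
        Summable (fun k : ℤ => (k : ℂ) • P k (U x))) ∧
      (∀ x : X, Summable (fun k : ℤ => (k : ℂ) • P k x) →
        (∑' k : ℤ, (k : ℂ) • P k (U x)) - B (U x)
          = U ((∑' k : ℤ, (k : ℂ) • P k x) - B₀ x)) := by
  obtain ⟨T, hnorm, hcont, hPT, hTP⟩ := exists_isometric_group P hidem hdisj hsum hT
  obtain ⟨J, hJ_le, hJ⟩ := exists_schur_multiplier P T hnorm hcont hPT hTP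
    (f := fun _ => (2 * Real.pi : ℂ)⁻¹) continuous_const
    (g := fun _ => (2 * Real.pi)⁻¹) continuous_const
    (fun _ => by simp [abs_of_pos Real.pi_pos])
  obtain ⟨Γ, hΓ_le, hΓ⟩ := exists_schur_multiplier P T hnorm hcont hPT hTP
    (f := fun t => (2 * Real.pi : ℂ)⁻¹ * (-Complex.I * (Real.pi - t))) (by fun_prop)
    (g := fun t => (2 * Real.pi)⁻¹ * (1 + (Real.pi - t) ^ 2 / 4)) (by fun_prop)
    (fun t => by
      have : ‖(Real.pi - t : ℂ)‖ = |Real.pi - t| := by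
        rw [← Complex.ofReal_sub, Complex.norm_real, Real.norm_eq_abs]
      simp only [norm_mul, norm_neg, Complex.norm_I, one_mul, this]
      rw [show ‖(2 * Real.pi : ℂ)⁻¹‖ = (2 * Real.pi)⁻¹ by simp [abs_of_pos Real.pi_pos]]
      have := Real.pi_pos
      gcongr
      nlinarith [sq_abs (Real.pi - t), sq_nonneg (|Real.pi - t| - 2)])
  have hJ_norm (S : X →L[ℂ] X) : ‖J S‖ ≤ ‖S‖ := by
    have h := hJ_le S
    rwa [intervalIntegral.integral_const, sub_zero, smul_eq_mul,
      mul_inv_cancel₀ Real.two_pi_pos.ne', one_mul] at h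
  have hΓ_norm (S : X →L[ℂ] X) : ‖Γ S‖ ≤ 2 * ‖S‖ := by
    refine (hΓ_le S).trans (mul_le_mul_of_nonneg_right ?_ (norm_nonneg S))
    have : ∫ t in (0 : ℝ)..2 * Real.pi, (2 * Real.pi)⁻¹ * (1 + (Real.pi - t) ^ 2 / 4) =
        1 + Real.pi ^ 2 / 12 := by
      rw [intervalIntegral.integral_const_mul, intervalIntegral.integral_add
        (Continuous.intervalIntegrable (by fun_prop) _ _)
        (Continuous.intervalIntegrable (by fun_prop) _ _), intervalIntegral.integral_div,
        intervalIntegral.integral_comp_sub_left (fun t => t ^ 2), integral_pow]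
      have := Real.pi_ne_zero
      simp
      field_simp
      ring
    rw [this]
    nlinarith [Real.pi_lt_d2, Real.pi_pos]
  have hJ_entry (S : X →L[ℂ] X) (k j : ℤ) (x : X) :
      P k (J S (P j x)) = if k = j then P k (S (P j x)) else 0 := by
    rw [hJ]
    have := integral_exp_int_mul (k - j)
    push_cast at this
    simp only [this, sub_eq_zero]
    split_ifs <;> simp
  have hcomm (S : X →L[ℂ] X) : HasCommutator P (Γ S) (S - J S) := by
    intro k j x
    have := int_mul_integral_sawtooth_mul_exp (k - j)
    push_cast at this
    rw [hΓ, smul_smul, this, sub_apply, map_sub, hJ_entry]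
    simp only [sub_eq_zero]
    split_ifs <;> simp
  have hB' : 14 * ‖B‖ < 1 := by
    have h3 : (1.7 : ℝ) < Real.sqrt 3 := Real.lt_sqrt_of_sq_lt (by norm_num)
    nlinarith [norm_nonneg B]
  obtain ⟨Y, hY, hY_le⟩ := exists_fixedPoint_similar J Γ hJ_norm hΓ_norm B hB'
  have hΓY : ‖Γ Y‖ < 1 := by linarith [hΓ_norm Y, norm_nonneg B]
  let u : (X →L[ℂ] X)ˣ := Units.oneSub (-Γ Y) (by rwa [norm_neg])
  have hu : (u : X →L[ℂ] X) = 1 + Γ Y := by simp [u]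
  have huV : (1 + Γ Y) * (↑u⁻¹ : X →L[ℂ] X) = 1 := by rw [← hu, u.mul_inv]
  have hVu : (↑u⁻¹ : X →L[ℂ] X) * (1 + Γ Y) = 1 := by rw [← hu, u.inv_mul]
  obtain ⟨Z, hZ⟩ := (hcomm Y).inverse hsum hdisj hΓY huV
  have hsumU (x : X) (hx : Summable (fun k : ℤ => (k : ℂ) • P k x)) :
      HasSum (fun k : ℤ => (k : ℂ) • P k ((1 + Γ Y) x))
        ((1 + Γ Y) (∑' k : ℤ, (k : ℂ) • P k x) + (Y - J Y) x) := by
    convert hx.hasSum.add ((hcomm Y).hasSum hsum hx) using 1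
    · ext k
      simp
    · simp only [add_apply, one_apply_eq_self]
      abel
  refine ⟨J Y, 1 + Γ Y, ↑u⁻¹, fun i j hij => ?_, huV, hVu, fun x => ⟨fun hx => ?_, fun hx => ?_⟩,
    fun x hx => ?_⟩
  · ext x
    simpa [hij] using hJ_entry Y i j x
  · exact (hsumU x hx).summable
  · have hVx : (↑u⁻¹ : X →L[ℂ] X) ((1 + Γ Y) x) = x := DFunLike.congr_fun hVu x
    simpa only [hVx] using (hZ.hasSum hsum hx).summable
  · rw [(hsumU x hx).tsum_eq]
    have hYx : Y x = B x + B (Γ Y x) - Γ Y (J Y x) := DFunLike.congr_fun hY x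
    simp only [add_apply, sub_apply, one_apply_eq_self, map_add, map_sub, hYx]
    abel
end

section
/- Let Z be a bounded linear operator on X whose matrix is strictly upper triangular, i.e. P_i Z P_j = 0 whenever i ≥ j, and suppose that I + Z is an idempotent, i.e. (I + Z)² = I + Z (equivalently Z + Z² = 0). Then Z = 0. (Matrix form of the paper's Lemma 3.8: a hypercausal perturbation of the identity that is an idempotent must be trivial.) -/
/-- If `∑ P k = I` strongly and every matrix entry of `A` in row `i` annihilates the corresponding
entry of `B` in column `j`, then the `(i, j)` entry of `A B` vanishes. -/
theorem apply_comp_eq_zero_of_hasSum {ι 𝕜 X : Type*} [NontriviallyNormedField 𝕜]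
    [NormedAddCommGroup X] [NormedSpace 𝕜 X] {P : ι → X →L[𝕜] X}
    (hsum : ∀ x : X, HasSum (fun k => P k x) x) (A B : X →L[𝕜] X) (i j : ι)
    (h : ∀ l x, P i (A (P l (B (P j x)))) = 0) (x : X) : P i (A (B (P j x))) = 0 := by
  have hs := ((P i).comp A).hasSum (hsum (B (P j x)))
  have h0 : HasSum (fun l => ((P i).comp A) (P l (B (P j x)))) 0 := by
    simp [h, hasSum_zero]
  exact hs.unique h0

/-- An operator all of whose matrix entries vanish is zero. -/
theorem eq_zero_of_forall_entry_eq_zero {ι 𝕜 X : Type*} [NontriviallyNormedField 𝕜]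
    [NormedAddCommGroup X] [NormedSpace 𝕜 X] {P : ι → X →L[𝕜] X}
    (hsum : ∀ x : X, HasSum (fun k => P k x) x) (Z : X →L[𝕜] X)
    (h : ∀ i j x, P i (Z (P j x)) = 0) : Z = 0 := by
  have hcol (j : ι) (x : X) : Z (P j x) = 0 := by
    have hs := hsum (Z (P j x))
    simp only [h] at hs
    exact hs.unique hasSum_zero
  ext x
  have hs := Z.hasSum (hsum x)
  simp only [hcol] at hs
  exact hs.unique hasSum_zero

/-- Matrix form of Lemma 3.8 of the paper: if `(P k)_{k∈ℤ}` is a disjunctive resolution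
of the identity on a complex Banach space, `Z` is a bounded operator whose matrix is
strictly upper triangular (`P_i Z P_j = 0` for `i ≥ j`), and `I + Z` is an idempotent,
then `Z = 0`. -/
theorem stmt12 {X : Type*} [NormedAddCommGroup X] [NormedSpace ℂ X] [CompleteSpace X]
    (P : ℤ → X →L[ℂ] X)
    (hidem : ∀ k, (P k).comp (P k) = P k)
    (hdisj : ∀ i j, i ≠ j → (P i).comp (P j) = 0)
    (hsum : ∀ x : X, HasSum (fun k : ℤ => P k x) x)
    (Z : X →L[ℂ] X)
    (hZ : ∀ i j : ℤ, j ≤ i → (P i).comp (Z.comp (P j)) = 0)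
    (hid : (ContinuousLinearMap.id ℂ X + Z).comp (ContinuousLinearMap.id ℂ X + Z)
      = ContinuousLinearMap.id ℂ X + Z) :
    Z = 0 := by
  have hZZ (x : X) : Z x = -Z (Z x) := by
    have hx := DFunLike.congr_fun hid x
    simp only [ContinuousLinearMap.comp_apply, add_apply,
      ContinuousLinearMap.id_apply, map_add] at hx
    exact eq_neg_of_add_eq_zero_left (by simpa using hx)
  have hZ' (i j : ℤ) (hij : j ≤ i) (x : X) : P i (Z (P j x)) = 0 :=
    DFunLike.congr_fun (hZ i j hij) x
  have hband (n : ℕ) : ∀ i j : ℤ, j ≤ i + n → ∀ x, P i (Z (P j x)) = 0 := by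
    induction n with
    | zero => exact fun i j hij => hZ' i j (by simpa using hij)
    | succ n ih =>
      intro i j hij x
      rw [hZZ, map_neg, neg_eq_zero]
      refine apply_comp_eq_zero_of_hasSum hsum Z Z i j (fun l y => ?_) x
      rcases le_or_gt j l with hl | hl
      · rw [hZ' l j hl, map_zero, map_zero]
      · exact ih i l (by push_cast at hij; omega) _
  exact eq_zero_of_forall_entry_eq_zero hsum Z fun i j =>
    hband (j - i).toNat i j (by have := Int.self_le_toNat (j - i); omega)
end

section
/- Let B be a bounded operator on H and let a > 0 satisfy 2a < d and (5.4·√3/a)·‖B‖ < 1. Then there exist a bounded operator C on H whose matrix is diagonal, i.e. P_i C P_j = 0 for all i ≠ j, and a bounded operator U on H with bounded inverse such that U(D(A)) = D(A) and (A − B)(Ux) = U(Ax − Cx) for all x ∈ D(A); that is, A − B is similar to an operator A − C with diagonal matrix. (The similarity theorem of Section 7 of the paper for self-adjoint operators with separated discrete spectrum.) -/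
/-- A resolution of the identity of a Hilbert space by mutually orthogonal projections. -/
structure IsOrthogonalResolution {ι H : Type*} [NormedAddCommGroup H] [InnerProductSpace ℂ H]
    [CompleteSpace H] (P : ι → H →L[ℂ] H) : Prop where
  adjoint_eq : ∀ k, ContinuousLinearMap.adjoint (P k) = P k
  comp_self : ∀ k, (P k).comp (P k) = P k
  comp_of_ne : ∀ i j, i ≠ j → (P i).comp (P j) = 0
  hasSum : ∀ x : H, HasSum (fun k => P k x) x

theorem exists_fixedPoint_of_isClosed {E : Type*} [NormedAddCommGroup E] [CompleteSpace E]
    {s : Set E} (hs : IsClosed s) {f : E → E} (hf : Set.MapsTo f s s) {K : ℝ} (hK0 : 0 ≤ K)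
    (hK : K < 1) (hlip : ∀ x ∈ s, ∀ y ∈ s, ‖f x - f y‖ ≤ K * ‖x - y‖) (hne : s.Nonempty) :
    ∃ x ∈ s, f x = x := by
  obtain ⟨x, hx⟩ := hne
  have hc : ContractingWith ⟨K, hK0⟩ (hf.restrict f s s) := by
    refine ⟨by exact_mod_cast hK, LipschitzWith.of_dist_le_mul fun x y => ?_⟩
    rw [Subtype.dist_eq, Subtype.dist_eq, dist_eq_norm, dist_eq_norm]
    exact hlip x x.2 y y.2
  obtain ⟨y, hy, hfix, -⟩ := hc.exists_fixedPoint' hs.isComplete hf hx (edist_ne_top _ _)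
  exact ⟨y, hy, hfix⟩

theorem hasSum_int_inv_sq : HasSum (fun n : ℤ => ((n : ℝ)⁻¹) ^ 2) (Real.pi ^ 2 / 3) := by
  have h : HasSum (fun n : ℕ => ((n : ℝ)⁻¹) ^ 2) (Real.pi ^ 2 / 6) := by
    simpa [one_div] using hasSum_zeta_two
  have := HasSum.of_nat_of_neg (f := fun n : ℤ => ((n : ℝ)⁻¹) ^ 2) (by simpa using h)
    (by simpa [inv_neg] using h)
  rwa [Int.cast_zero, inv_zero, zero_pow two_ne_zero, sub_zero, ← add_div, ← two_mul,
    show 2 * Real.pi ^ 2 / 6 = Real.pi ^ 2 / 3 by ring] at this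

theorem inv_sq_le_inv_floor_sq {t : ℝ} (ht : 1 ≤ |t|) : (t⁻¹) ^ 2 ≤ 4 * ((⌊t⌋ : ℝ)⁻¹) ^ 2 := by
  have h1 := Int.floor_le t
  have h2 := Int.lt_floor_add_one t
  have hn : (⌊t⌋ : ℝ) ≠ 0 := by
    intro h
    rw [h] at h1 h2
    rw [abs_of_nonneg h1] at ht
    linarith
  have ht0 : t ≠ 0 := by
    rintro rfl
    norm_num at ht
  have hsq : (⌊t⌋ : ℝ) ^ 2 ≤ 4 * t ^ 2 := by
    rcases le_abs'.1 ht with h | h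
    · nlinarith
    · have : (1 : ℝ) ≤ ⌊t⌋ := by exact_mod_cast Int.le_floor.2 (by simpa using h)
      nlinarith
  have hn2 : 0 < (⌊t⌋ : ℝ) ^ 2 := by positivity
  have ht2 : 0 < t ^ 2 := by positivity
  rw [inv_pow, inv_pow, ← div_eq_mul_inv, inv_eq_one_div, div_le_div_iff₀ ht2 hn2]
  linarith

theorem sum_inv_sub_sq_le {ι : Type*} {lam : ι → ℝ} {d : ℝ} (hd : 0 < d)
    (hsep : ∀ i j, i ≠ j → d ≤ |lam i - lam j|) (F : Finset ι) (j : ι) :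
    ∑ k ∈ F, ((lam k - lam j)⁻¹) ^ 2 ≤ (4 / d) ^ 2 := by
  classical
  set n : ι → ℤ := fun k => ⌊(lam k - lam j) / d⌋ with hn
  have hinj : Function.Injective n := by
    intro k l hkl
    by_contra hne
    have h1 := Int.abs_sub_lt_one_of_floor_eq_floor hkl
    rw [← sub_div, abs_div, abs_of_pos hd, div_lt_one hd] at h1
    have h2 := hsep k l hne
    rw [show lam k - lam j - (lam l - lam j) = lam k - lam l by ring] at h1
    linarith
  have hterm : ∀ k ∈ F, ((lam k - lam j)⁻¹) ^ 2 ≤ 4 / d ^ 2 * ((n k : ℝ)⁻¹) ^ 2 := by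
    intro k _
    by_cases hkj : k = j
    · subst hkj
      simp [hn]
    · have ht : 1 ≤ |(lam k - lam j) / d| := by
        rw [abs_div, abs_of_pos hd, one_le_div hd]
        exact hsep k j hkj
      have h := inv_sq_le_inv_floor_sq ht
      have e : ((lam k - lam j)⁻¹) ^ 2 = 1 / d ^ 2 * (((lam k - lam j) / d)⁻¹) ^ 2 := by
        rw [inv_div]
        field_simp
      rw [e]
      calc _ ≤ 1 / d ^ 2 * (4 * ((n k : ℝ)⁻¹) ^ 2) := by gcongr
        _ = _ := by ring
  have hpi : Real.pi ^ 2 / 3 ≤ 4 := by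
    nlinarith [Real.pi_lt_d2, Real.pi_pos]
  calc _ ≤ ∑ k ∈ F, 4 / d ^ 2 * ((n k : ℝ)⁻¹) ^ 2 := Finset.sum_le_sum hterm
    _ = 4 / d ^ 2 * ∑ m ∈ F.image n, ((m : ℝ)⁻¹) ^ 2 := by
      rw [Finset.sum_image hinj.injOn, Finset.mul_sum]
    _ ≤ 4 / d ^ 2 * 4 := by
      gcongr
      exact (sum_le_hasSum _ (fun _ _ => by positivity) hasSum_int_inv_sq).trans hpi
    _ = _ := by ring

section

open ContinuousLinearMap (map_smul_of_tower)

/-- If `Γ` is small and commutes with the diagonal operator up to a bounded operator, then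
`1 + Γ` maps no vector from outside the domain into it. -/
theorem exists_domain_of_add_apply {ι H : Type*} [NormedAddCommGroup H] [NormedSpace ℂ H]
    [CompleteSpace H] {P : ι → H →L[ℂ] H} {lam : ι → ℝ} {Γ Z : H →L[ℂ] H}
    (hΓ : ‖Γ‖ ≤ 1 / 2)
    (hcomm : ∀ {x v : H}, (∀ k, P k v = lam k • P k x) →
      ∀ k, P k (Γ v + Z x) = lam k • P k (Γ x))
    {x w : H} (hw : ∀ k, P k w = lam k • P k (x + Γ x)) :
    ∃ v, ∀ k, P k v = lam k • P k x := by
  obtain ⟨t, ht0, ht⟩ : ∃ t : ℝ, 0 < t ∧ t * ‖Z‖ ≤ 1 / 4 := by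
    refine ⟨1 / (4 * (‖Z‖ + 1)), by positivity, ?_⟩
    rw [div_mul_eq_mul_div, div_le_iff₀ (by positivity)]
    linarith [norm_nonneg Z]
  let G : Set (H × H) := {p | ∀ k, P k p.2 = lam k • P k (t • p.1)}
  have hG : IsClosed G := by
    simp only [G, Set.ofPred_forall]
    exact isClosed_iInter fun k => isClosed_eq (by fun_prop) (by fun_prop)
  let f : H × H → H × H := fun p => (x + Γ x - Γ p.1, t • w - (Γ p.2 + Z (t • p.1)))
  have hmaps : Set.MapsTo f G G := by
    intro p hp k
    have h1 := hcomm hp k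
    simp only [f]
    rw [map_sub, h1, map_smul_of_tower, hw, smul_sub, map_sub, smul_sub, map_smul_of_tower Γ,
      map_smul_of_tower (P k) t (x + Γ x), smul_comm t]
  have hΓle : ∀ y, ‖Γ y‖ ≤ 1 / 2 * ‖y‖ := fun y => Γ.le_of_opNorm_le hΓ y
  have hlip : ∀ p ∈ G, ∀ q ∈ G, ‖f p - f q‖ ≤ 3 / 4 * ‖p - q‖ := by
    intro p _ q _
    have e : f p - f q = -(Γ (p - q).1, Γ (p - q).2 + t • Z (p - q).1) := by
      refine Prod.ext ?_ ?_
      · simp only [f, Prod.fst_sub, Prod.fst_neg, map_sub]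
        abel
      · simp only [f, Prod.snd_sub, Prod.fst_sub, Prod.snd_neg, map_sub, map_smul_of_tower,
          smul_sub]
        abel
    rw [e, norm_neg]
    have h1 := norm_fst_le (p - q)
    have h2 := norm_snd_le (p - q)
    refine norm_prod_le_iff.2 ⟨?_, ?_⟩
    · linarith [hΓle (p - q).1, norm_nonneg (p - q)]
    · calc _ ≤ ‖Γ (p - q).2‖ + t * (‖Z‖ * ‖(p - q).1‖) := by
            refine (norm_add_le _ _).trans ?_
            rw [norm_smul, Real.norm_of_nonneg ht0.le]
            gcongr
            exact Z.le_opNorm _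
        _ ≤ 1 / 2 * ‖p - q‖ + 1 / 4 * ‖p - q‖ := by
            rw [← mul_assoc]
            gcongr
            linarith [hΓle (p - q).2]
        _ = _ := by ring
  obtain ⟨⟨y, v⟩, hy, hfix⟩ := exists_fixedPoint_of_isClosed hG hmaps (by norm_num) (by norm_num)
    hlip ⟨0, fun k => by simp⟩
  have hfst : x + Γ x - Γ y = y := congrArg Prod.fst hfix
  have hxy : x = y := by
    have h1 : x - y = -Γ (x - y) := by
      rw [map_sub]
      nth_rewrite 1 [← hfst]
      abel
    have h2 : ‖x - y‖ ≤ 1 / 2 * ‖x - y‖ := by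
      nth_rewrite 1 [h1]
      rw [norm_neg]
      exact hΓle _
    exact sub_eq_zero.1 (norm_le_zero_iff.1 (by linarith))
  subst hxy
  refine ⟨t⁻¹ • v, fun k => ?_⟩
  have h := hy k
  simp only at h
  rw [map_smul_of_tower, h, map_smul_of_tower, smul_comm t⁻¹, inv_smul_smul₀ ht0.ne']

namespace IsOrthogonalResolution

variable {ι H : Type*} [NormedAddCommGroup H] [InnerProductSpace ℂ H] [CompleteSpace H]
  {P : ι → H →L[ℂ] H}

theorem apply_self (hP : IsOrthogonalResolution P) (k : ι) (x : H) : P k (P k x) = P k x :=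
  congrArg (fun T : H →L[ℂ] H => T x) (hP.comp_self k)

theorem apply_of_ne (hP : IsOrthogonalResolution P) {i j : ι} (h : i ≠ j) (x : H) :
    P i (P j x) = 0 :=
  congrArg (fun T : H →L[ℂ] H => T x) (hP.comp_of_ne i j h)

theorem ext (hP : IsOrthogonalResolution P) {x y : H} (h : ∀ k, P k x = P k y) : x = y := by
  have hx := hP.hasSum x
  simp only [h] at hx
  exact hx.unique (hP.hasSum y)

theorem inner_apply (hP : IsOrthogonalResolution P) (k : ι) (x y : H) :
    inner ℂ (P k x) y = inner ℂ x (P k y) := by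
  rw [← ContinuousLinearMap.adjoint_inner_left, hP.adjoint_eq]

theorem hasSum_norm_sq (hP : IsOrthogonalResolution P) (x : H) :
    HasSum (fun k => ‖P k x‖ ^ 2) (‖x‖ ^ 2) := by
  have h := (hP.hasSum x).mapL (innerSL ℂ x)
  have h2 := h.mapL Complex.reCLM
  convert h2 using 1
  · ext k
    have : inner ℂ x (P k x) = inner ℂ (P k x) (P k x) := by
      rw [hP.inner_apply, hP.apply_self]
    simp only [innerSL_apply_apply, this, Complex.reCLM_apply]
    exact norm_sq_eq_re_inner (𝕜 := ℂ) _
  · exact norm_sq_eq_re_inner (𝕜 := ℂ) _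

theorem norm_apply_le (hP : IsOrthogonalResolution P) (k : ι) (x : H) : ‖P k x‖ ≤ ‖x‖ := by
  have := le_hasSum (hP.hasSum_norm_sq x) k fun _ _ => by positivity
  exact (sq_le_sq₀ (norm_nonneg _) (norm_nonneg _)).1 this

theorem apply_of_hasSum (hP : IsOrthogonalResolution P) {z : ι → H} {v : H}
    (h : HasSum (fun k => P k (z k)) v) (k : ι) : P k v = P k (z k) := by
  have h1 := h.mapL (P k)
  refine h1.unique ?_
  convert hasSum_single (f := fun j => P k (P j (z j))) k
    (fun j hj => hP.apply_of_ne hj.symm _) using 1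
  exact (hP.apply_self k _).symm

theorem summable_of_summable_norm_sq (hP : IsOrthogonalResolution P) {z : ι → H}
    (h : Summable fun k => ‖P k (z k)‖ ^ 2) : Summable fun k => P k (z k) := by
  have hV : OrthogonalFamily ℂ (fun k => (P k).range) fun k => (P k).range.subtypeₗᵢ := by
    rintro i j hij ⟨_, x, rfl⟩ ⟨_, y, rfl⟩
    change inner ℂ (P i x) (P j y) = 0
    rw [hP.inner_apply, hP.apply_of_ne hij, inner_zero_right]
  exact (hV.summable_iff_norm_sq_summable fun k => ⟨P k (z k), z k, rfl⟩).2 h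

/-- A family of operators whose rows are jointly square-bounded assembles to one operator. -/
theorem exists_apply_eq (hP : IsOrthogonalResolution P) (T : ι → H →L[ℂ] H) {M : ℝ} (hM : 0 ≤ M)
    (hT : ∀ (x : H) (F : Finset ι), ∑ k ∈ F, ‖P k (T k x)‖ ^ 2 ≤ (M * ‖x‖) ^ 2) :
    ∃ S : H →L[ℂ] H, (∀ x k, P k (S x) = P k (T k x)) ∧ ‖S‖ ≤ M := by
  have hsum : ∀ x, Summable fun k => P k (T k x) := fun x =>
    hP.summable_of_summable_norm_sq
      (summable_of_sum_le (fun _ => by positivity) (hT x))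
  have hcoord : ∀ x k, P k (∑' j, P j (T j x)) = P k (T k x) := fun x k =>
    hP.apply_of_hasSum (hsum x).hasSum k
  let S : H →ₗ[ℂ] H :=
    { toFun := fun x => ∑' k, P k (T k x)
      map_add' := fun x y => hP.ext fun k => by
        rw [hcoord, map_add, map_add, map_add, hcoord, hcoord]
      map_smul' := fun c x => hP.ext fun k => by
        rw [hcoord, map_smul, map_smul, RingHom.id_apply, map_smul, hcoord] }
  have hS : ∀ x k, P k (S x) = P k (T k x) := hcoord
  have hbound : ∀ x, ‖S x‖ ≤ M * ‖x‖ := by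
    intro x
    have h := hP.hasSum_norm_sq (S x)
    simp only [hS] at h
    exact (sq_le_sq₀ (norm_nonneg _) (by positivity)).1 (hasSum_le_of_sum_le h (hT x))
  exact ⟨S.mkContinuous M hbound, hS, S.mkContinuous_norm_le hM hbound⟩

theorem exists_diagonal (hP : IsOrthogonalResolution P) (c : ι → ℝ) {M : ℝ} (hM : 0 ≤ M)
    (hc : ∀ k, |c k| ≤ M) : ∃ S : H →L[ℂ] H, ∀ x k, P k (S x) = c k • P k x := by
  obtain ⟨S, hS, -⟩ := hP.exists_apply_eq
    (fun k => (c k : ℂ) • ContinuousLinearMap.id ℂ H) hM fun x F => by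
      calc _ ≤ ∑ k ∈ F, M ^ 2 * ‖P k x‖ ^ 2 := by
            refine Finset.sum_le_sum fun k _ => ?_
            simp only [smul_apply, ContinuousLinearMap.id_apply, map_smul,
              norm_smul, Complex.norm_real, Real.norm_eq_abs, mul_pow]
            gcongr
            exact hc k
        _ = M ^ 2 * ∑ k ∈ F, ‖P k x‖ ^ 2 := (Finset.mul_sum ..).symm
        _ ≤ M ^ 2 * ‖x‖ ^ 2 := by
            gcongr
            exact sum_le_hasSum _ (fun _ _ => by positivity) (hP.hasSum_norm_sq x)
        _ = _ := by ring
  exact ⟨S, fun x k => by simp [hS]⟩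

theorem exists_diagonalPart (hP : IsOrthogonalResolution P) (X : H →L[ℂ] H) :
    ∃ S : H →L[ℂ] H, (∀ x k, P k (S x) = P k (X (P k x))) ∧ ‖S‖ ≤ ‖X‖ := by
  refine hP.exists_apply_eq (fun k => X.comp (P k)) (norm_nonneg X) fun x F => ?_
  calc _ ≤ ∑ k ∈ F, ‖X‖ ^ 2 * ‖P k x‖ ^ 2 := by
        refine Finset.sum_le_sum fun k _ => ?_
        rw [← mul_pow]
        gcongr
        exact (hP.norm_apply_le k _).trans (X.le_opNorm _)
    _ = ‖X‖ ^ 2 * ∑ k ∈ F, ‖P k x‖ ^ 2 := (Finset.mul_sum ..).symm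
    _ ≤ ‖X‖ ^ 2 * ‖x‖ ^ 2 := by
        gcongr
        exact sum_le_hasSum _ (fun _ _ => by positivity) (hP.hasSum_norm_sq x)
    _ = _ := by ring

theorem exists_reducedResolvent (hP : IsOrthogonalResolution P) {lam : ι → ℝ} {d : ℝ} (hd : 0 < d)
    (hsep : ∀ i j, i ≠ j → d ≤ |lam i - lam j|) (k : ι) :
    ∃ R : H →L[ℂ] H, ∀ x j, P j (R x) = (lam k - lam j)⁻¹ • P j x := by
  refine hP.exists_diagonal (fun j => (lam k - lam j)⁻¹) (inv_nonneg.2 hd.le) fun j => ?_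
  by_cases h : k = j
  · subst h
    simpa using hd.le
  · rw [abs_inv]
    exact inv_anti₀ hd (hsep k j h)

/-- The Schur multiplier with symbol `(lam i - lam j)⁻¹`. -/
theorem exists_sylvester (hP : IsOrthogonalResolution P) {lam : ι → ℝ} {d : ℝ} (hd : 0 < d)
    (hsep : ∀ i j, i ≠ j → d ≤ |lam i - lam j|) {R : ι → H →L[ℂ] H}
    (hR : ∀ k x j, P j (R k x) = (lam k - lam j)⁻¹ • P j x) (X : H →L[ℂ] H) :
    ∃ S : H →L[ℂ] H, (∀ x k, P k (S x) = P k (X (R k x))) ∧ ‖S‖ ≤ 4 / d * ‖X‖ := by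
  refine hP.exists_apply_eq (fun k => X.comp (R k)) (by positivity) fun x F => ?_
  have hsum : HasSum (fun j => ∑ k ∈ F, ‖P j (R k x)‖ ^ 2) (∑ k ∈ F, ‖R k x‖ ^ 2) :=
    hasSum_sum fun k _ => hP.hasSum_norm_sq (R k x)
  have hle : ∑ k ∈ F, ‖R k x‖ ^ 2 ≤ (4 / d) ^ 2 * ‖x‖ ^ 2 := by
    refine hasSum_le (fun j => ?_) hsum ((hP.hasSum_norm_sq x).mul_left _)
    simp only [hR, norm_smul, mul_pow, Real.norm_eq_abs, sq_abs, ← Finset.sum_mul]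
    gcongr
    exact sum_inv_sub_sq_le hd hsep F j
  calc _ ≤ ∑ k ∈ F, ‖X‖ ^ 2 * ‖R k x‖ ^ 2 := by
        refine Finset.sum_le_sum fun k _ => ?_
        rw [← mul_pow]
        gcongr
        exact (hP.norm_apply_le k _).trans (X.le_opNorm _)
    _ = ‖X‖ ^ 2 * ∑ k ∈ F, ‖R k x‖ ^ 2 := (Finset.mul_sum ..).symm
    _ ≤ ‖X‖ ^ 2 * ((4 / d) ^ 2 * ‖x‖ ^ 2) := by gcongr
    _ = _ := by ring

theorem hasSum_smul (hP : IsOrthogonalResolution P) {lam : ι → ℝ} {x v : H}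
    (h : ∀ k, P k v = lam k • P k x) : HasSum (fun k => lam k • P k x) v := by
  simpa only [h] using hP.hasSum v

theorem apply_tsum_smul (hP : IsOrthogonalResolution P) {lam : ι → ℝ} {x : H}
    (h : Summable fun k => lam k • P k x) (k : ι) :
    P k (∑' j, lam j • P j x) = lam k • P k x := by
  have hs := h.hasSum
  simp only [← map_smul_of_tower] at hs
  simpa using hP.apply_of_hasSum (z := fun j => lam j • x) (by simpa using hs) k

/-- The commutator identity `A Γ - Γ A = Y - D` for the solution `Γ` of the Sylvester equation. -/
theorem apply_sylvester (hP : IsOrthogonalResolution P) {lam : ι → ℝ}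
    (hinj : ∀ i j, i ≠ j → lam i - lam j ≠ 0) {R : ι → H →L[ℂ] H}
    (hR : ∀ k x j, P j (R k x) = (lam k - lam j)⁻¹ • P j x) {Y Γ D : H →L[ℂ] H}
    (hΓ : ∀ x k, P k (Γ x) = P k (Y (R k x))) (hD : ∀ x k, P k (D x) = P k (Y (P k x)))
    {x v : H} (h : ∀ k, P k v = lam k • P k x) (k : ι) :
    P k (Γ v + (Y x - D x)) = lam k • P k (Γ x) := by
  have key : R k v + (x - P k x) = lam k • R k x := by
    refine hP.ext fun j => ?_
    rw [map_smul_of_tower, map_add, map_sub, hR, hR, h]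
    by_cases hkj : k = j
    · subst hkj
      simp [hP.apply_self]
    · rw [hP.apply_of_ne (Ne.symm hkj), sub_zero, smul_smul, smul_smul]
      nth_rewrite 2 [← one_smul ℝ (P j x)]
      rw [← add_smul]
      congr 1
      have := hinj k j hkj
      field_simp
      ring
  rw [map_add, map_sub, hΓ, hD, hΓ, ← map_sub, ← map_sub, ← map_add, ← map_add, key,
    map_smul_of_tower, map_smul_of_tower]

/-- The fixed point equation of the method of similar operators. -/
theorem exists_similarity (hP : IsOrthogonalResolution P) {lam : ι → ℝ} {d : ℝ} (hd : 0 < d)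
    (hsep : ∀ i j, i ≠ j → d ≤ |lam i - lam j|) {R : ι → H →L[ℂ] H}
    (hR : ∀ k x j, P j (R k x) = (lam k - lam j)⁻¹ • P j x) (B : H →L[ℂ] H)
    (hB : 4 / d * ‖B‖ ≤ 2 / 9) :
    ∃ Γ C : H →L[ℂ] H, ‖Γ‖ ≤ 1 / 2 ∧
      (∀ x k, P k (C x) = P k ((B + B * Γ) (P k x))) ∧
      ∀ x k, P k (Γ x) = P k ((B + B * Γ - Γ * C) (R k x)) := by
  choose D hD hDn using hP.exists_diagonalPart
  choose L hL hLn using hP.exists_sylvester hd hsep hR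
  have hDsub : ∀ X Y, D X - D Y = D (X - Y) := fun X Y =>
    ContinuousLinearMap.ext fun x => hP.ext fun k => by simp [hD]
  have hLsub : ∀ X Y, L X - L Y = L (X - Y) := fun X Y =>
    ContinuousLinearMap.ext fun x => hP.ext fun k => by simp [hL]
  let Y : (H →L[ℂ] H) → (H →L[ℂ] H) := fun Γ => B + B * Γ - Γ * D (B + B * Γ)
  have hnB : ∀ Γ : H →L[ℂ] H, ‖Γ‖ ≤ 1 / 2 → ‖B + B * Γ‖ ≤ ‖B‖ * (3 / 2) := fun Γ hΓ =>
    calc _ ≤ ‖B‖ + ‖B‖ * ‖Γ‖ := (norm_add_le _ _).trans (by gcongr; exact norm_mul_le _ _)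
      _ ≤ ‖B‖ + ‖B‖ * (1 / 2) := by gcongr
      _ = _ := by ring
  have hmaps : Set.MapsTo (fun Γ => L (Y Γ)) (Metric.closedBall 0 (1 / 2))
      (Metric.closedBall 0 (1 / 2)) := by
    intro Γ hΓ
    rw [mem_closedBall_zero_iff] at hΓ ⊢
    have hY : ‖Y Γ‖ ≤ ‖B‖ * (9 / 4) :=
      calc _ ≤ ‖B + B * Γ‖ + ‖Γ‖ * ‖D (B + B * Γ)‖ :=
            (norm_sub_le _ _).trans (by gcongr; exact norm_mul_le _ _)
        _ ≤ ‖B‖ * (3 / 2) + 1 / 2 * (‖B‖ * (3 / 2)) := by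
            gcongr
            · exact hnB Γ hΓ
            · exact (hDn _).trans (hnB Γ hΓ)
        _ = _ := by ring
    calc _ ≤ 4 / d * (‖B‖ * (9 / 4)) := (hLn _).trans (by gcongr)
      _ ≤ 1 / 2 := by linarith
  have hlip : ∀ Γ ∈ Metric.closedBall (0 : H →L[ℂ] H) (1 / 2),
      ∀ Δ ∈ Metric.closedBall (0 : H →L[ℂ] H) (1 / 2),
      ‖L (Y Γ) - L (Y Δ)‖ ≤ 2 / 3 * ‖Γ - Δ‖ := by
    intro Γ hΓ Δ hΔ
    rw [mem_closedBall_zero_iff] at hΓ hΔ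
    have e : Y Γ - Y Δ =
        B * (Γ - Δ) - ((Γ - Δ) * D (B + B * Γ) + Δ * D (B * (Γ - Δ))) := by
      have : D (B * (Γ - Δ)) = D (B + B * Γ) - D (B + B * Δ) := by
        rw [hDsub]
        congr 1
        noncomm_ring
      rw [this]
      simp only [Y]
      noncomm_ring
    have hY : ‖Y Γ - Y Δ‖ ≤ ‖B‖ * 3 * ‖Γ - Δ‖ := by
      rw [e]
      calc _ ≤ ‖B‖ * ‖Γ - Δ‖ +
            (‖Γ - Δ‖ * ‖D (B + B * Γ)‖ + ‖Δ‖ * ‖D (B * (Γ - Δ))‖) := by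
            refine (norm_sub_le _ _).trans (add_le_add (norm_mul_le _ _) ?_)
            exact (norm_add_le _ _).trans (add_le_add (norm_mul_le _ _) (norm_mul_le _ _))
        _ ≤ ‖B‖ * ‖Γ - Δ‖ +
            (‖Γ - Δ‖ * (‖B‖ * (3 / 2)) + 1 / 2 * (‖B‖ * ‖Γ - Δ‖)) := by
            gcongr
            · exact (hDn _).trans (hnB Γ hΓ)
            · exact (hDn _).trans (norm_mul_le _ _)
        _ = _ := by ring
    rw [hLsub]
    calc _ ≤ 4 / d * (‖B‖ * 3 * ‖Γ - Δ‖) := (hLn _).trans (by gcongr)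
      _ = 4 / d * ‖B‖ * (3 * ‖Γ - Δ‖) := by ring
      _ ≤ 2 / 9 * (3 * ‖Γ - Δ‖) := by gcongr
      _ = _ := by ring
  obtain ⟨Γ, hΓ, hfix⟩ := exists_fixedPoint_of_isClosed Metric.isClosed_closedBall hmaps
    (by norm_num) (by norm_num) hlip ⟨0, by simp⟩
  refine ⟨Γ, D (B + B * Γ), mem_closedBall_zero_iff.1 hΓ, hD _, fun x k => ?_⟩
  have h := hL (Y Γ) x k
  rwa [show L (Y Γ) = Γ from hfix] at h

end IsOrthogonalResolution

end

/-- The similarity theorem of Section 7 of the paper for a self-adjoint operator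
`A x = Σ λ_k P_k x` on a complex Hilbert space with separated discrete spectrum
(`|λ_i − λ_j| ≥ d > 0` for `i ≠ j`): if `2a < d` and `(5.4√3/a)‖B‖ < 1`, then `A − B`
is similar to an operator `A − C` whose matrix is diagonal. -/
theorem stmt13 {H : Type*} [NormedAddCommGroup H] [InnerProductSpace ℂ H] [CompleteSpace H]
    (lam : ℤ → ℝ) (d : ℝ) (hd : 0 < d)
    (hsep : ∀ i j : ℤ, i ≠ j → d ≤ |lam i - lam j|)
    (P : ℤ → H →L[ℂ] H)
    (hsa : ∀ k, ContinuousLinearMap.adjoint (P k) = P k)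
    (hidem : ∀ k, (P k).comp (P k) = P k)
    (hdisj : ∀ i j, i ≠ j → (P i).comp (P j) = 0)
    (hsum : ∀ x : H, HasSum (fun k : ℤ => P k x) x)
    (B : H →L[ℂ] H) (a : ℝ) (ha : 0 < a) (had : 2 * a < d)
    (hB : 5.4 * Real.sqrt 3 / a * ‖B‖ < 1) :
    ∃ (C U V : H →L[ℂ] H),
      (∀ i j : ℤ, i ≠ j → (P i).comp (C.comp (P j)) = 0) ∧
      U.comp V = ContinuousLinearMap.id ℂ H ∧
      V.comp U = ContinuousLinearMap.id ℂ H ∧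
      (∀ x : H, Summable (fun k : ℤ => lam k • P k x) ↔
        Summable (fun k : ℤ => lam k • P k (U x))) ∧
      (∀ x : H, Summable (fun k : ℤ => lam k • P k x) →
        (∑' k : ℤ, lam k • P k (U x)) - B (U x)
          = U ((∑' k : ℤ, lam k • P k x) - C x)) := by
  have hP : IsOrthogonalResolution P := ⟨hsa, hidem, hdisj, hsum⟩
  have hBd : 4 / d * ‖B‖ ≤ 2 / 9 := by
    have h3 : (5 / 3 : ℝ) ≤ Real.sqrt 3 := Real.le_sqrt_of_sq_le (by norm_num)
    rw [div_mul_eq_mul_div, div_lt_one ha] at hB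
    rw [div_mul_eq_mul_div, div_le_iff₀ hd]
    nlinarith [mul_le_mul_of_nonneg_right h3 (norm_nonneg B)]
  choose R hR using hP.exists_reducedResolvent hd hsep
  obtain ⟨Γ, C, hΓn, hC, hΓ⟩ := hP.exists_similarity hd hsep hR B hBd
  have hCP : ∀ x k, C (P k x) = P k (C x) := fun x k => hP.ext fun j => by
    by_cases h : j = k
    · subst h
      rw [hC, hP.apply_self, hP.apply_self, hC]
    · rw [hC, hP.apply_of_ne h, hP.apply_of_ne h, map_zero, map_zero]
  have hRP : ∀ x k, R k (P k x) = 0 := fun x k => hP.ext fun j => by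
    by_cases h : j = k
    · subst h
      simp [hR]
    · rw [hR, hP.apply_of_ne h, smul_zero, map_zero]
  have hD : ∀ x k, P k (C x) = P k ((B + B * Γ - Γ * C) (P k x)) := fun x k => by
    have h0 : P k (Γ (C (P k x))) = 0 := by
      rw [hCP, hΓ, hRP, map_zero, map_zero]
    rw [sub_apply, map_sub, hC, mul_apply_eq_comp, h0, sub_zero]
  have hinj : ∀ i j, i ≠ j → lam i - lam j ≠ 0 := fun i j hij h => by
    have := hsep i j hij
    rw [h, abs_zero] at this
    linarith
  have hcomm : ∀ {x v : H}, (∀ k, P k v = lam k • P k x) →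
      ∀ k, P k (Γ v + (B + B * Γ - Γ * C - C) x) = lam k • P k (Γ x) := fun h k =>
    hP.apply_sylvester hinj hR hΓ hD h k
  have hU : ∀ {x v : H}, (∀ k, P k v = lam k • P k x) →
      ∀ k, P k (v + (Γ v + (B + B * Γ - Γ * C - C) x)) = lam k • P k ((1 + Γ) x) := fun h k => by
    rw [map_add, hcomm h, h, add_apply, map_add, smul_add]
    rfl
  obtain ⟨u, hu⟩ : IsUnit (1 + Γ) := by
    rw [← sub_neg_eq_add]
    exact isUnit_one_sub_of_norm_lt_one (by rw [norm_neg]; linarith)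
  refine ⟨C, 1 + Γ, ↑u⁻¹, fun i j hij => ?_, ?_, ?_, fun x => ⟨fun h => ?_, fun h => ?_⟩,
    fun x h => ?_⟩
  · ext x
    simp [hCP, hP.apply_of_ne hij]
  · rw [← hu]
    exact u.mul_inv
  · rw [← hu]
    exact u.inv_mul
  · exact (hP.hasSum_smul (hU (hP.apply_tsum_smul h))).summable
  · obtain ⟨v, hv⟩ := exists_domain_of_add_apply hΓn hcomm (hP.apply_tsum_smul h)
    exact (hP.hasSum_smul hv).summable
  · rw [(hP.hasSum_smul (hU (hP.apply_tsum_smul h))).tsum_eq]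
    simp only [add_apply, sub_apply, mul_apply_eq_comp, one_apply_eq_self, map_add, map_sub]
    abel
end

section
/- Let f ∈ L¹(ℝ, ℂ) and let X be a bounded operator on H, and for t ∈ ℝ let T(t) be the unitary operator T(t)x = Σ_{k∈ℤ} e^{iλ_k t} P_k x. Then for every x ∈ H the Bochner integral Yx = ∫_ℝ f(t)·T(−t)(X(T(t)x)) dt exists, the map Y so defined is a bounded linear operator on H, and its matrix entries are P_i Y P_j = f̂(λ_i − λ_j)·P_i X P_j for all i, j ∈ ℤ, where f̂(λ) = ∫_ℝ f(t)e^{−iλt} dt. (The lemma of Section 7 of the paper computing the matrix of the operator 𝒯₀(f)X.) -/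
open MeasureTheory

section SpectralFamily

variable {H : Type*} [NormedAddCommGroup H] [InnerProductSpace ℂ H] {P : ℤ → H →L[ℂ] H}

/-- The projections diagonalise an operator given by a multiplier. -/
theorem resolution_apply_of_hasSum_smul
    (hidem : ∀ k, (P k).comp (P k) = P k)
    (hdisj : ∀ i j, i ≠ j → (P i).comp (P j) = 0)
    {c : ℤ → ℂ} {x y : H} (hy : HasSum (fun k : ℤ => c k • P k x) y) (i : ℤ) :
    P i y = c i • P i x := by
  refine (hy.mapL (P i)).unique ?_
  convert hasSum_single i fun k hk => ?_ using 1
  · rw [map_smul, ← ContinuousLinearMap.comp_apply, hidem i]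
  · rw [map_smul, ← ContinuousLinearMap.comp_apply, hdisj i k hk.symm]
    simp

/-- An operator given by a multiplier acts as a scalar on the range of each projection. -/
theorem eq_smul_of_hasSum_smul_resolution
    (hidem : ∀ k, (P k).comp (P k) = P k)
    (hdisj : ∀ i j, i ≠ j → (P i).comp (P j) = 0)
    {c : ℤ → ℂ} {j : ℤ} {x y : H} (hy : HasSum (fun k : ℤ => c k • P k (P j x)) y) :
    y = c j • P j x := by
  refine hy.unique ?_
  convert hasSum_single j fun k hk => ?_ using 1
  · rw [← ContinuousLinearMap.comp_apply, hidem j]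
  · rw [← ContinuousLinearMap.comp_apply, hdisj k j hk]
    simp

/-- A continuous family of multipliers preserves strong measurability. -/
theorem aestronglyMeasurable_of_hasSum_smul {c : ℤ → ℝ → ℂ} (hc : ∀ k, Continuous (c k))
    {g G : ℝ → H} (hg : AEStronglyMeasurable g volume)
    (hG : ∀ t, HasSum (fun k : ℤ => c k t • P k (g t)) (G t)) :
    AEStronglyMeasurable G volume := by
  refine aestronglyMeasurable_of_tendsto_ae Filter.atTop
    (f := fun (s : Finset ℤ) t => ∑ k ∈ s, c k t • P k (g t)) (fun s => ?_)
    (Filter.Eventually.of_forall hG)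
  exact Finset.aestronglyMeasurable_fun_sum s fun k _ =>
    (hc k).aestronglyMeasurable.smul ((P k).continuous.comp_aestronglyMeasurable hg)

variable [CompleteSpace H]

/-- Parseval's identity for a resolution of the identity by orthogonal projections. -/
theorem hasSum_norm_sq_of_resolution
    (hsa : ∀ k, ContinuousLinearMap.adjoint (P k) = P k)
    (hidem : ∀ k, (P k).comp (P k) = P k)
    (hsum : ∀ x : H, HasSum (fun k : ℤ => P k x) x) (x : H) :
    HasSum (fun k : ℤ => ‖P k x‖ ^ 2) (‖x‖ ^ 2) := by
  have h := ((hsum x).mapL (innerSL ℂ x)).mapL Complex.reCLM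
  have hk : ∀ k, Complex.re (inner ℂ x (P k x)) = ‖P k x‖ ^ 2 := fun k => by
    have h1 : inner ℂ (P k x) (P k x) = inner ℂ x (P k x) := by
      conv_lhs => rw [← ContinuousLinearMap.adjoint_inner_right, hsa k,
        ← ContinuousLinearMap.comp_apply, hidem k]
    rw [← h1]
    exact inner_self_eq_norm_sq (𝕜 := ℂ) (P k x)
  have hx : Complex.re (inner ℂ x x) = ‖x‖ ^ 2 := inner_self_eq_norm_sq (𝕜 := ℂ) x
  simp only [← hx, ← hk]
  exact h

/-- A multiplier of modulus one defines an isometry. -/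
theorem norm_eq_of_hasSum_smul_resolution
    (hsa : ∀ k, ContinuousLinearMap.adjoint (P k) = P k)
    (hidem : ∀ k, (P k).comp (P k) = P k)
    (hdisj : ∀ i j, i ≠ j → (P i).comp (P j) = 0)
    (hsum : ∀ x : H, HasSum (fun k : ℤ => P k x) x)
    {c : ℤ → ℂ} (hc : ∀ k, ‖c k‖ = 1) {x y : H}
    (hy : HasSum (fun k : ℤ => c k • P k x) y) : ‖y‖ = ‖x‖ := by
  have h := hasSum_norm_sq_of_resolution hsa hidem hsum y
  simp only [resolution_apply_of_hasSum_smul hidem hdisj hy, norm_smul, hc, one_mul] at h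
  have := h.unique (hasSum_norm_sq_of_resolution hsa hidem hsum x)
  exact (sq_eq_sq₀ (norm_nonneg _) (norm_nonneg _)).1 this

end SpectralFamily

/-- The lemma of Section 7 of the paper computing the matrix of the operator
`𝒯₀(f)X = ∫ f(t)·T(−t)X T(t) dt`, where `T(t)x = Σ e^{iλ_k t} P_k x`:
for `f ∈ L¹(ℝ, ℂ)` and a bounded operator `X` on `H`, the Bochner integral
`Y x = ∫ f(t)·T(−t)(X(T(t)x)) dt` exists for every `x`, defines a bounded operator `Y`,
and `P_i Y P_j = f̂(λ_i − λ_j)·P_i X P_j` for all `i, j ∈ ℤ`. -/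
theorem stmt14 {H : Type*} [NormedAddCommGroup H] [InnerProductSpace ℂ H] [CompleteSpace H]
    (lam : ℤ → ℝ) (d : ℝ) (hd : 0 < d)
    (hsep : ∀ i j : ℤ, i ≠ j → d ≤ |lam i - lam j|)
    (P : ℤ → H →L[ℂ] H)
    (hsa : ∀ k, ContinuousLinearMap.adjoint (P k) = P k)
    (hidem : ∀ k, (P k).comp (P k) = P k)
    (hdisj : ∀ i j, i ≠ j → (P i).comp (P j) = 0)
    (hsum : ∀ x : H, HasSum (fun k : ℤ => P k x) x)
    (f : ℝ → ℂ) (hf : Integrable f volume)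
    (Xop : H →L[ℂ] H)
    (T : ℝ → H →L[ℂ] H)
    (hT : ∀ (t : ℝ) (x : H),
      HasSum (fun k : ℤ => Complex.exp (Complex.I * lam k * t) • P k x) (T t x)) :
    (∀ x : H, Integrable (fun t : ℝ => f t • T (-t) (Xop (T t x))) volume) ∧
    ∃ Y : H →L[ℂ] H,
      (∀ x : H, Y x = ∫ t : ℝ, f t • T (-t) (Xop (T t x))) ∧
      (∀ i j : ℤ, (P i).comp (Y.comp (P j)) =
        (∫ t : ℝ, f t * Complex.exp (-(Complex.I * (lam i - lam j) * t))) •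
          ((P i).comp (Xop.comp (P j)))) := by
  have hexp : ∀ (t : ℝ) (k : ℤ), ‖Complex.exp (Complex.I * lam k * t)‖ = 1 := fun t k => by
    rw [show Complex.I * lam k * t = ((lam k * t : ℝ) : ℂ) * Complex.I by push_cast; ring]
    exact Complex.norm_exp_ofReal_mul_I _
  have hnorm : ∀ t x, ‖T t x‖ = ‖x‖ := fun t x =>
    norm_eq_of_hasSum_smul_resolution hsa hidem hdisj hsum (hexp t) (hT t x)
  have hbound : ∀ (x : H) (t : ℝ), ‖f t • T (-t) (Xop (T t x))‖ ≤ ‖f t‖ * (‖Xop‖ * ‖x‖) :=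
    fun x t => by
      rw [norm_smul, hnorm]
      gcongr
      simpa only [hnorm] using Xop.le_opNorm (T t x)
  have hmeas : ∀ x : H, AEStronglyMeasurable (fun t : ℝ => T (-t) (Xop (T t x))) volume := by
    intro x
    have h : AEStronglyMeasurable (fun t : ℝ => T t x) volume :=
      aestronglyMeasurable_of_hasSum_smul
        (c := fun k t => Complex.exp (Complex.I * lam k * t)) (fun k => by fun_prop)
        (g := fun _ => x) aestronglyMeasurable_const fun t => hT t x
    exact aestronglyMeasurable_of_hasSum_smul
      (c := fun k t => Complex.exp (Complex.I * lam k * (-t : ℝ))) (fun k => by fun_prop)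
      (Xop.continuous.comp_aestronglyMeasurable h) fun t => hT (-t) _
  have hInt : ∀ x : H, Integrable (fun t : ℝ => f t • T (-t) (Xop (T t x))) volume := fun x =>
    (hf.norm.mul_const (‖Xop‖ * ‖x‖)).mono' (hf.aestronglyMeasurable.smul (hmeas x))
      (Filter.Eventually.of_forall (hbound x))
  refine ⟨hInt, LinearMap.mkContinuous
    { toFun := fun x => ∫ t : ℝ, f t • T (-t) (Xop (T t x))
      map_add' := fun x y => by
        simp only [map_add, smul_add]
        exact integral_add (hInt x) (hInt y)
      map_smul' := fun a x => by
        simp only [map_smul, smul_comm _ a, RingHom.id_apply]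
        exact integral_smul a _ } ((∫ t, ‖f t‖) * ‖Xop‖) fun x => ?_, fun x => rfl,
    fun i j => ContinuousLinearMap.ext fun x => ?_⟩
  · refine (norm_integral_le_of_norm_le (hf.norm.mul_const (‖Xop‖ * ‖x‖))
      (Filter.Eventually.of_forall (hbound x))).trans_eq ?_
    rw [integral_mul_const, mul_assoc]
  · change P i (∫ t : ℝ, f t • T (-t) (Xop (T t (P j x)))) =
      (∫ t : ℝ, f t * Complex.exp (-(Complex.I * (lam i - lam j) * t))) • P i (Xop (P j x))
    rw [← (P i).integral_comp_comm (hInt (P j x)), ← integral_smul_const]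
    refine integral_congr_ae (Filter.Eventually.of_forall fun t => ?_)
    simp only [map_smul, resolution_apply_of_hasSum_smul hidem hdisj (hT (-t) _) i,
      eq_smul_of_hasSum_smul_resolution hidem hdisj (hT t (P j x)), smul_smul, mul_assoc,
      ← Complex.exp_add]
    congr 3
    push_cast
    ring
end
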